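/- arXiv:2101.03440 — 2 statements merged into one kernel-verified Lean document; each statement's English description precedes it below -/
import Mathlib

section
/- There exist absolute constants C₁ and C₂ such that uniformly for all positive integers k and all real x ≥ 2, #{ integers n with 4 < n ≤ x : n − 1 and n + 1 are both prime and ω(n/6) = k } ≤ C₁ · x · (log log x + C₂)^{k−1} / ((k−1)! · (log x)³). (Note that every n > 4 with n − 1 and n + 1 both prime is divisible by 6.) -/
open Finset

section SelbergSieve

variable {ι α : Type*}

variable {P : Finset ι} {g : ι → ℝ} {D : Finset (Finset ι)}

theorem selbergSum_pos (hg0 : ∀ i ∈ P, 0 < g i) (hg1 : ∀ i ∈ P, g i < 1)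
    (hDP : ∀ S ∈ D, S ⊆ P) (hne : ∅ ∈ D) :
    0 < ∑ N ∈ D, ∏ i ∈ N, g i / (1 - g i) := by
  apply Finset.sum_pos _ ⟨_, hne⟩
  intro S hS
  apply Finset.prod_pos
  intro i hi
  exact div_pos (hg0 i (hDP S hS hi)) (sub_pos.2 (hg1 i (hDP S hS hi)))

variable [DecidableEq ι]

/-- The Selberg weights attached to local densities `g` and a family `D` of index sets. -/
noncomputable def selbergWeight (g : ι → ℝ) (D : Finset (Finset ι)) (S : Finset ι) : ℝ :=
  (-1) ^ S.card * (∏ i ∈ S, g i)⁻¹ * (∑ N ∈ D, ∏ i ∈ N, g i / (1 - g i))⁻¹ *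
    ∑ N ∈ D with S ⊆ N, ∏ i ∈ N, g i / (1 - g i)

theorem sum_supersets_neg_one_pow (E N : Finset ι) :
    ∑ S ∈ N.powerset with E ⊆ S, (-1 : ℝ) ^ S.card = if N = E then (-1) ^ E.card else 0 := by
  by_cases hEN : E ⊆ N
  · have h1 : ∑ S ∈ N.powerset with E ⊆ S, (-1 : ℝ) ^ S.card
        = ∑ T ∈ (N \ E).powerset, (-1 : ℝ) ^ E.card * (-1) ^ T.card := by
      refine Finset.sum_nbij' (fun S => S \ E) (fun T => T ∪ E) ?_ ?_ ?_ ?_ ?_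
      · intro S hS
        simp only [mem_filter, mem_powerset] at hS ⊢
        exact sdiff_subset_sdiff hS.1 le_rfl
      · intro T hT
        simp only [mem_filter, mem_powerset] at hT ⊢
        exact ⟨union_subset (hT.trans sdiff_subset) hEN, subset_union_right⟩
      · intro S hS
        simp only [mem_filter, mem_powerset] at hS
        exact sdiff_union_of_subset hS.2
      · intro T hT
        simp only [mem_powerset] at hT
        exact union_sdiff_cancel_right (disjoint_sdiff.symm.mono_left hT)
      · intro S hS
        simp only [mem_filter, mem_powerset] at hS
        rw [← pow_add, add_comm, card_sdiff_add_card_eq_card hS.2]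
    rw [h1, ← mul_sum]
    have h2 : ∑ T ∈ (N \ E).powerset, (-1 : ℝ) ^ T.card = if N \ E = ∅ then 1 else 0 := by
      exact_mod_cast Finset.sum_powerset_neg_one_pow_card (x := N \ E)
    rw [h2]
    by_cases h : N = E
    · simp [h]
    · have : N \ E ≠ ∅ := by
        intro h3
        exact h (subset_antisymm (sdiff_eq_empty_iff_subset.mp h3) hEN)
      simp [h, this]
  · have : N ≠ E := by rintro rfl; exact hEN le_rfl
    rw [if_neg this]
    apply Finset.sum_eq_zero
    intro S hS
    simp only [mem_filter, mem_powerset] at hS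
    exact absurd (hS.2.trans hS.1) hEN

theorem selbergWeight_empty (hg0 : ∀ i ∈ P, 0 < g i) (hg1 : ∀ i ∈ P, g i < 1)
    (hDP : ∀ S ∈ D, S ⊆ P) (hne : ∅ ∈ D) : selbergWeight g D ∅ = 1 := by
  have := selbergSum_pos hg0 hg1 hDP hne
  simp [selbergWeight, -Finset.prod_div_distrib, this.ne']

theorem abs_selbergWeight_le (hg0 : ∀ i ∈ P, 0 < g i) (hg1 : ∀ i ∈ P, g i < 1)
    (hDP : ∀ S ∈ D, S ⊆ P) (hne : ∅ ∈ D) (hdown : ∀ S ∈ D, ∀ T ⊆ S, T ∈ D)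
    {S : Finset ι} (hS : S ∈ D) :
    |selbergWeight g D S| ≤ ∏ i ∈ S, (1 - g i)⁻¹ := by
  have hG := selbergSum_pos hg0 hg1 hDP hne
  set G := ∑ N ∈ D, ∏ i ∈ N, g i / (1 - g i) with hGdef
  have hh : ∀ N ∈ D, 0 ≤ ∏ i ∈ N, g i / (1 - g i) := fun N hN => Finset.prod_nonneg fun i hi =>
    (div_pos (hg0 i (hDP N hN hi)) (sub_pos.2 (hg1 i (hDP N hN hi)))).le
  have hgS : 0 < ∏ i ∈ S, g i := Finset.prod_pos fun i hi => hg0 i (hDP S hS hi)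
  have key : ∑ N ∈ D with S ⊆ N, ∏ i ∈ N, g i / (1 - g i)
      ≤ (∏ i ∈ S, g i / (1 - g i)) * G := by
    have h1 : ∑ N ∈ D with S ⊆ N, ∏ i ∈ N, g i / (1 - g i)
        = ∑ M ∈ (D.filter (S ⊆ ·)).image (· \ S),
            (∏ i ∈ S, g i / (1 - g i)) * ∏ i ∈ M, g i / (1 - g i) := by
      rw [Finset.sum_image]
      · refine Finset.sum_congr rfl fun N hN => ?_
        rw [mul_comm, Finset.prod_sdiff (mem_filter.1 hN).2]
      · intro N hN M hM h
        simp only [coe_filter, Set.mem_ofPred_eq] at hN hM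
        rw [← sdiff_union_of_subset hN.2, ← sdiff_union_of_subset hM.2]
        simp only at h
        rw [h]
    rw [h1, ← mul_sum]
    refine mul_le_mul_of_nonneg_left ?_ (hh S hS)
    refine Finset.sum_le_sum_of_subset_of_nonneg ?_ fun N hN _ => hh N hN
    intro M hM
    simp only [mem_image, mem_filter] at hM
    obtain ⟨N, hN, rfl⟩ := hM
    exact hdown N hN.1 _ sdiff_subset
  have hnn : 0 ≤ ∑ N ∈ D with S ⊆ N, ∏ i ∈ N, g i / (1 - g i) :=
    Finset.sum_nonneg fun N hN => hh N (mem_filter.1 hN).1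
  unfold selbergWeight
  rw [abs_mul, abs_mul, abs_mul, abs_pow, abs_neg, abs_one, one_pow, one_mul,
    abs_of_pos (inv_pos.2 hgS), abs_of_pos (inv_pos.2 hG), abs_of_nonneg hnn]
  calc _ ≤ (∏ i ∈ S, g i)⁻¹ * G⁻¹ * ((∏ i ∈ S, g i / (1 - g i)) * G) := by gcongr
    _ = ∏ i ∈ S, (1 - g i)⁻¹ := by
      simp only [div_eq_mul_inv, prod_mul_distrib]
      field_simp

theorem sum_mul_selbergWeight (hg0 : ∀ i ∈ P, 0 < g i)
    (hDP : ∀ S ∈ D, S ⊆ P) (hdown : ∀ S ∈ D, ∀ T ⊆ S, T ∈ D)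
    {E : Finset ι} (hE : E ∈ D) :
    ∑ S ∈ D with E ⊆ S, (∏ i ∈ S, g i) * selbergWeight g D S
      = (-1) ^ E.card * (∏ i ∈ E, g i / (1 - g i)) *
        (∑ N ∈ D, ∏ i ∈ N, g i / (1 - g i))⁻¹ := by
  set G := ∑ N ∈ D, ∏ i ∈ N, g i / (1 - g i) with hGdef
  have h1 : ∀ S ∈ D.filter (E ⊆ ·), (∏ i ∈ S, g i) * selbergWeight g D S
      = ∑ N ∈ D, G⁻¹ * (∏ i ∈ N, g i / (1 - g i)) * if S ⊆ N then (-1 : ℝ) ^ S.card else 0 := by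
    intro S hS
    have hgS : 0 < ∏ i ∈ S, g i :=
      Finset.prod_pos fun i hi => hg0 i (hDP S (mem_filter.1 hS).1 hi)
    unfold selbergWeight
    rw [← hGdef, Finset.sum_filter, Finset.mul_sum, Finset.mul_sum]
    refine Finset.sum_congr rfl fun N _ => ?_
    split_ifs
    · field_simp
    · simp
  rw [Finset.sum_congr rfl h1, Finset.sum_comm]
  have h2 : ∀ N ∈ D, ∑ S ∈ D with E ⊆ S,
      G⁻¹ * (∏ i ∈ N, g i / (1 - g i)) * (if S ⊆ N then (-1 : ℝ) ^ S.card else 0)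
      = if N = E then G⁻¹ * (∏ i ∈ E, g i / (1 - g i)) * (-1) ^ E.card else 0 := by
    intro N hN
    rw [← Finset.mul_sum, ← Finset.sum_filter]
    have : (D.filter (E ⊆ ·)).filter (· ⊆ N) = N.powerset.filter (E ⊆ ·) := by
      ext S
      simp only [mem_filter, mem_powerset]
      exact ⟨fun h => ⟨h.2, h.1.2⟩, fun h => ⟨⟨hdown N hN S h.1, h.2⟩, h.1⟩⟩
    rw [this, sum_supersets_neg_one_pow]
    split_ifs with h
    · rw [h]
    · simp
  rw [Finset.sum_congr rfl h2, Finset.sum_ite_eq' D E, if_pos hE]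
  ring

theorem prod_union_eq_sum (hg0 : ∀ i ∈ P, 0 < g i)
    (hDP : ∀ S ∈ D, S ⊆ P) (hdown : ∀ S ∈ D, ∀ T ⊆ S, T ∈ D)
    {S : Finset ι} (hS : S ∈ D) (T : Finset ι) :
    ∏ i ∈ S ∪ T, g i = ∑ E ∈ D, (∏ i ∈ E, g i / (1 - g i))⁻¹ *
      ((if E ⊆ S then ∏ i ∈ S, g i else 0) * if E ⊆ T then ∏ i ∈ T, g i else 0) := by
  have h1 : ∏ i ∈ S ∩ T, (g i)⁻¹
      = ∑ E ∈ D with E ⊆ S ∩ T, (∏ i ∈ E, g i / (1 - g i))⁻¹ := by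
    have h3 : D.filter (· ⊆ S ∩ T) = (S ∩ T).powerset := by
      ext E
      simp only [mem_filter, mem_powerset]
      exact ⟨fun h => h.2, fun h => ⟨hdown S hS E (h.trans inter_subset_left), h⟩⟩
    rw [h3]
    calc ∏ i ∈ S ∩ T, (g i)⁻¹ = ∏ i ∈ S ∩ T, (1 + (g i / (1 - g i))⁻¹) := by
          refine Finset.prod_congr rfl fun i hi => ?_
          have := hg0 i (hDP S hS (mem_inter.1 hi).1)
          field_simp
          ring
      _ = _ := by
          rw [Finset.prod_one_add]
          simp only [Finset.prod_inv_distrib]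
  have h2 : ∏ i ∈ S ∪ T, g i = (∏ i ∈ S, g i) * (∏ i ∈ T, g i) * ∏ i ∈ S ∩ T, (g i)⁻¹ := by
    rw [← Finset.prod_union_inter, mul_assoc, ← Finset.prod_mul_distrib]
    rw [Finset.prod_eq_one (s := S ∩ T), mul_one]
    intro i hi
    exact mul_inv_cancel₀ (hg0 i (hDP S hS (mem_inter.1 hi).1)).ne'
  rw [h2, h1, Finset.sum_filter, Finset.mul_sum]
  refine Finset.sum_congr rfl fun E _ => ?_
  by_cases h : E ⊆ S <;> by_cases h' : E ⊆ T <;> simp [subset_inter_iff, h, h', mul_comm]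

theorem selbergWeight_quadratic_form (hg0 : ∀ i ∈ P, 0 < g i) (hg1 : ∀ i ∈ P, g i < 1)
    (hDP : ∀ S ∈ D, S ⊆ P) (hne : ∅ ∈ D) (hdown : ∀ S ∈ D, ∀ T ⊆ S, T ∈ D) :
    ∑ S ∈ D, ∑ T ∈ D, selbergWeight g D S * selbergWeight g D T * ∏ i ∈ S ∪ T, g i
      = (∑ N ∈ D, ∏ i ∈ N, g i / (1 - g i))⁻¹ := by
  have hG := selbergSum_pos hg0 hg1 hDP hne
  set G := ∑ N ∈ D, ∏ i ∈ N, g i / (1 - g i) with hGdef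
  set w := selbergWeight g D with hw
  have h1 : ∑ S ∈ D, ∑ T ∈ D, w S * w T * ∏ i ∈ S ∪ T, g i
      = ∑ E ∈ D, (∏ i ∈ E, g i / (1 - g i))⁻¹ *
          ((∑ S ∈ D with E ⊆ S, (∏ i ∈ S, g i) * w S) *
            (∑ S ∈ D with E ⊆ S, (∏ i ∈ S, g i) * w S)) := by
    calc _ = ∑ S ∈ D, ∑ T ∈ D, ∑ E ∈ D, (∏ i ∈ E, g i / (1 - g i))⁻¹ *
            ((if E ⊆ S then (∏ i ∈ S, g i) * w S else 0) *
              (if E ⊆ T then (∏ i ∈ T, g i) * w T else 0)) := by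
          refine Finset.sum_congr rfl fun S hS => Finset.sum_congr rfl fun T _ => ?_
          rw [prod_union_eq_sum hg0 hDP hdown hS T, Finset.mul_sum]
          refine Finset.sum_congr rfl fun E _ => ?_
          split_ifs <;> ring
      _ = ∑ S ∈ D, ∑ E ∈ D, ∑ T ∈ D, (∏ i ∈ E, g i / (1 - g i))⁻¹ *
            ((if E ⊆ S then (∏ i ∈ S, g i) * w S else 0) *
              (if E ⊆ T then (∏ i ∈ T, g i) * w T else 0)) :=
          Finset.sum_congr rfl fun S _ => Finset.sum_comm
      _ = ∑ E ∈ D, ∑ S ∈ D, ∑ T ∈ D, (∏ i ∈ E, g i / (1 - g i))⁻¹ *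
            ((if E ⊆ S then (∏ i ∈ S, g i) * w S else 0) *
              (if E ⊆ T then (∏ i ∈ T, g i) * w T else 0)) := Finset.sum_comm
      _ = _ := by
          refine Finset.sum_congr rfl fun E _ => ?_
          rw [Finset.sum_filter, Finset.sum_mul_sum, Finset.mul_sum]
          refine Finset.sum_congr rfl fun S _ => ?_
          rw [Finset.mul_sum]
  rw [h1]
  have h2 : ∀ E ∈ D, (∏ i ∈ E, g i / (1 - g i))⁻¹ *
          ((∑ S ∈ D with E ⊆ S, (∏ i ∈ S, g i) * w S) *
            (∑ S ∈ D with E ⊆ S, (∏ i ∈ S, g i) * w S))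
        = (∏ i ∈ E, g i / (1 - g i)) * (G⁻¹ * G⁻¹) := by
    intro E hE
    rw [hw, sum_mul_selbergWeight hg0 hDP hdown hE, ← hGdef]
    have : 0 < ∏ i ∈ E, g i / (1 - g i) := Finset.prod_pos fun i hi =>
      div_pos (hg0 i (hDP E hE hi)) (sub_pos.2 (hg1 i (hDP E hE hi)))
    have hs : ((-1 : ℝ) ^ E.card) * (-1) ^ E.card = 1 := by
      rw [← mul_pow]; norm_num
    set p := ∏ i ∈ E, g i / (1 - g i)
    calc _ = (p⁻¹ * p) * ((-1 : ℝ) ^ E.card * (-1) ^ E.card) * (p * (G⁻¹ * G⁻¹)) := by ring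
      _ = _ := by rw [hs, inv_mul_cancel₀ this.ne']; ring
  rw [Finset.sum_congr rfl h2, ← Finset.sum_mul, ← hGdef, ← mul_assoc,
    mul_inv_cancel₀ hG.ne', one_mul]

/-- Selberg's upper bound sieve, with sifting conditions indexed by an arbitrary finite set and
with a crude form of the remainder. -/
theorem selberg_sieve (U : Finset α) (A : ι → α → Prop) [∀ i, DecidablePred (A i)]
    (hg0 : ∀ i ∈ P, 0 < g i) (hg1 : ∀ i ∈ P, g i < 1)
    (hDP : ∀ S ∈ D, S ⊆ P) (hne : ∅ ∈ D) (hdown : ∀ S ∈ D, ∀ T ⊆ S, T ∈ D)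
    (X R L : ℝ)
    (hR : ∀ S ∈ D, ∀ T ∈ D,
      |((U.filter fun u => ∀ i ∈ S ∪ T, A i u).card : ℝ) - X * ∏ i ∈ S ∪ T, g i| ≤ R)
    (hL : ∀ S ∈ D, ∏ i ∈ S, (1 - g i)⁻¹ ≤ L) :
    ((U.filter fun u => ∀ i ∈ P, ¬ A i u).card : ℝ)
      ≤ X * (∑ N ∈ D, ∏ i ∈ N, g i / (1 - g i))⁻¹ + R * (D.card * L) ^ 2 := by
  set w := selbergWeight g D with hw
  have hwL : ∀ S ∈ D, |w S| ≤ L := fun S hS =>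
    (abs_selbergWeight_le hg0 hg1 hDP hne hdown hS).trans (hL S hS)
  have hL0 : 0 ≤ L := (abs_nonneg _).trans (hwL _ hne)
  have hR0 : 0 ≤ R := (abs_nonneg _).trans (hR _ hne _ hne)
  have h1 : ((U.filter fun u => ∀ i ∈ P, ¬ A i u).card : ℝ)
      ≤ ∑ u ∈ U, (∑ S ∈ D, if ∀ i ∈ S, A i u then w S else 0) ^ 2 := by
    rw [Finset.card_filter, Nat.cast_sum]
    refine Finset.sum_le_sum fun u _ => ?_
    split_ifs with h
    · rw [Finset.sum_eq_single ∅]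
      · simp [hw, selbergWeight_empty hg0 hg1 hDP hne]
      · intro S hS hSe
        obtain ⟨i, hi⟩ := Finset.nonempty_iff_ne_empty.2 hSe
        rw [if_neg]
        intro h2
        exact h i (hDP S hS hi) (h2 i hi)
      · exact fun h => absurd hne h
    · simp only [Nat.cast_zero]; positivity
  have h2 : ∑ u ∈ U, (∑ S ∈ D, if ∀ i ∈ S, A i u then w S else 0) ^ 2
      = ∑ S ∈ D, ∑ T ∈ D, w S * w T * ((U.filter fun u => ∀ i ∈ S ∪ T, A i u).card : ℝ) := by
    calc _ = ∑ u ∈ U, ∑ S ∈ D, ∑ T ∈ D,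
          w S * w T * (if ∀ i ∈ S ∪ T, A i u then (1 : ℝ) else 0) := by
          refine Finset.sum_congr rfl fun u _ => ?_
          rw [sq, Finset.sum_mul_sum]
          refine Finset.sum_congr rfl fun S _ => Finset.sum_congr rfl fun T _ => ?_
          have : (∀ i ∈ S ∪ T, A i u) ↔ (∀ i ∈ S, A i u) ∧ ∀ i ∈ T, A i u := by
            simp only [mem_union, or_imp, forall_and]
          simp only [this]
          by_cases a : ∀ i ∈ S, A i u
          · by_cases b : ∀ i ∈ T, A i u
            · rw [if_pos a, if_pos b, if_pos (And.intro a b), mul_one]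
            · have hab : ¬ ((∀ i ∈ S, A i u) ∧ ∀ i ∈ T, A i u) := fun h => b h.2
              rw [if_neg b, if_neg hab, mul_zero, mul_zero]
          · have hab : ¬ ((∀ i ∈ S, A i u) ∧ ∀ i ∈ T, A i u) := fun h => a h.1
            rw [if_neg a, if_neg hab, zero_mul, mul_zero]
      _ = ∑ S ∈ D, ∑ u ∈ U, ∑ T ∈ D,
          w S * w T * (if ∀ i ∈ S ∪ T, A i u then (1 : ℝ) else 0) := Finset.sum_comm
      _ = _ := by
          refine Finset.sum_congr rfl fun S _ => ?_
          rw [Finset.sum_comm]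
          refine Finset.sum_congr rfl fun T _ => ?_
          rw [← Finset.mul_sum, Finset.card_filter]
          push_cast
          rfl
  have h3 : ∑ S ∈ D, ∑ T ∈ D, w S * w T * ((U.filter fun u => ∀ i ∈ S ∪ T, A i u).card : ℝ)
      ≤ ∑ S ∈ D, ∑ T ∈ D, (X * (w S * w T * ∏ i ∈ S ∪ T, g i) + L * L * R) := by
    refine Finset.sum_le_sum fun S hS => Finset.sum_le_sum fun T hT => ?_
    have e : w S * w T * ((U.filter fun u => ∀ i ∈ S ∪ T, A i u).card : ℝ)
        = X * (w S * w T * ∏ i ∈ S ∪ T, g i) + w S * w T *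
          (((U.filter fun u => ∀ i ∈ S ∪ T, A i u).card : ℝ) - X * ∏ i ∈ S ∪ T, g i) := by ring
    rw [e]
    refine add_le_add le_rfl ((le_abs_self _).trans ?_)
    rw [abs_mul, abs_mul]
    exact mul_le_mul (mul_le_mul (hwL S hS) (hwL T hT) (abs_nonneg _) hL0) (hR S hS T hT)
      (abs_nonneg _) (by positivity)
  rw [h2] at h1
  refine h1.trans (h3.trans (le_of_eq ?_))
  simp only [Finset.sum_add_distrib, ← Finset.mul_sum, Finset.sum_const, nsmul_eq_mul]
  rw [hw, selbergWeight_quadratic_form hg0 hg1 hDP hne hdown]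
  ring

end SelbergSieve

theorem card_filter_range_mul_of_periodic {m n : ℕ} (hmn : m.Coprime n) (hm : 0 < m) (hn : 0 < n)
    {A B : ℕ → Prop} [DecidablePred A] [DecidablePred B]
    (hA : Function.Periodic A m) (hB : Function.Periodic B n) :
    ((range (m * n)).filter fun u => A u ∧ B u).card
      = ((range m).filter A).card * ((range n).filter B).card := by
  rw [← Finset.card_product]
  have hA' : ∀ u, A (u % m) = A u := hA.map_mod_nat
  have hB' : ∀ u, B (u % n) = B u := hB.map_mod_nat
  refine Finset.card_bij' (fun u _ => (u % m, u % n))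
    (fun v _ => (Nat.chineseRemainder hmn v.1 v.2 : ℕ)) ?_ ?_ ?_ ?_
  · intro u hu
    simp only [mem_filter, mem_range, mem_product] at hu ⊢
    rw [hA', hB']
    exact ⟨⟨Nat.mod_lt _ hm, hu.2.1⟩, Nat.mod_lt _ hn, hu.2.2⟩
  · intro v hv
    simp only [mem_filter, mem_range, mem_product] at hv ⊢
    have h1 := (Nat.chineseRemainder hmn v.1 v.2).2
    refine ⟨Nat.chineseRemainder_lt_mul hmn _ _ hm.ne' hn.ne', ?_, ?_⟩
    · rw [← hA', h1.1, hA']; exact hv.1.2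
    · rw [← hB', h1.2, hB']; exact hv.2.2
  · intro u hu
    simp only [mem_filter, mem_range] at hu
    have h1 := (Nat.chineseRemainder hmn (u % m) (u % n)).2
    have h2 := Nat.chineseRemainder_modEq_unique hmn
      (a := u % m) (b := u % n) (z := u) (Nat.mod_modEq _ _).symm (Nat.mod_modEq _ _).symm
    have h3 := Nat.chineseRemainder_lt_mul hmn (u % m) (u % n) hm.ne' hn.ne'
    exact (Nat.ModEq.eq_of_lt_of_lt h2 hu.1 h3).symm
  · intro v hv
    simp only [mem_filter, mem_range, mem_product] at hv
    have h1 := (Nat.chineseRemainder hmn v.1 v.2).2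
    ext
    · exact Eq.trans h1.1 (Nat.mod_eq_of_lt hv.1.1)
    · exact Eq.trans h1.2 (Nat.mod_eq_of_lt hv.2.1)

theorem periodic_forall_mem {A : ℕ → ℕ → Prop} {S : Finset ℕ}
    (hA : ∀ p ∈ S, Function.Periodic (A p) p) :
    Function.Periodic (fun u => ∀ p ∈ S, A p u) (∏ p ∈ S, p) := by
  intro u
  simp only [eq_iff_iff]
  refine forall₂_congr fun p hp => ?_
  obtain ⟨c, hc⟩ := Finset.dvd_prod_of_mem (fun p => p) hp
  rw [hc, mul_comm p c, ← (hA p hp).nat_mul c u]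
  simp

theorem card_filter_range_prod_of_periodic {A : ℕ → ℕ → Prop} [∀ p, DecidablePred (A p)]
    {S : Finset ℕ} (hS : ∀ p ∈ S, p.Prime) (hA : ∀ p ∈ S, Function.Periodic (A p) p) :
    ((range (∏ p ∈ S, p)).filter fun u => ∀ p ∈ S, A p u).card
      = ∏ p ∈ S, ((range p).filter (A p)).card := by
  induction S using Finset.induction_on with
  | empty => simp
  | insert q S hq ih =>
    have hS' : ∀ p ∈ S, p.Prime := fun p hp => hS p (mem_insert_of_mem hp)
    have hA' : ∀ p ∈ S, Function.Periodic (A p) p := fun p hp => hA p (mem_insert_of_mem hp)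
    have hqp := hS q (mem_insert_self _ _)
    rw [Finset.prod_insert hq, Finset.prod_insert hq, ← ih hS' hA',
      ← card_filter_range_mul_of_periodic _ hqp.pos (Finset.prod_pos fun p hp => (hS' p hp).pos)
        (hA q (mem_insert_self _ _)) (periodic_forall_mem hA')]
    · congr 1
      ext u
      simp only [mem_filter, mem_range, mem_insert, forall_eq_or_imp]
    · refine Nat.Coprime.prod_right fun p hp => ?_
      rw [Nat.coprime_primes hqp (hS' p hp)]
      rintro rfl
      exact hq hp

theorem abs_card_filter_Ico_sub_le_of_periodic {A : ℕ → Prop} [DecidablePred A] {l : ℕ}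
    (hl : 0 < l) (hA : Function.Periodic A l) (N : ℕ) :
    |(((Ico 1 (N + 1)).filter A).card : ℝ) - N * (((range l).filter A).card / l)| ≤ l := by
  have hl' : (0 : ℝ) < l := by exact_mod_cast hl
  induction N using Nat.strong_induction_on with
  | _ N ih =>
    rcases lt_or_ge N l with h | h
    · have h1 : ((Ico 1 (N + 1)).filter A).card ≤ N := by
        refine (card_filter_le _ _).trans ?_
        simp
      have h2 : ((range l).filter A).card ≤ l := by
        refine (card_filter_le _ _).trans ?_
        simp
      have h1' : (((Ico 1 (N + 1)).filter A).card : ℝ) ≤ N := by exact_mod_cast h1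
      have h3 : (((range l).filter A).card : ℝ) / l ≤ 1 := by
        rw [div_le_one hl']; exact_mod_cast h2
      have h4 : (N : ℝ) ≤ l := by exact_mod_cast h.le
      have h5 : (0 : ℝ) ≤ ((range l).filter A).card / l := by positivity
      have h6 : (0 : ℝ) ≤ N := by positivity
      have h7 : (0 : ℝ) ≤ ((Ico 1 (N + 1)).filter A).card := by positivity
      rw [abs_le]
      constructor <;> nlinarith
    · obtain ⟨M, rfl⟩ := Nat.exists_eq_add_of_le' h
      have h1 : ((Ico 1 (M + l + 1)).filter A).card
          = ((Ico 1 (M + 1)).filter A).card + ((range l).filter A).card := by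
        have : Ico 1 (M + l + 1) = Ico 1 (M + 1) ∪ Ico (M + 1) (M + 1 + l) := by
          rw [Finset.Ico_union_Ico_eq_Ico (by omega) (by omega)]
          congr 1; omega
        rw [this, filter_union, card_union_of_disjoint, Nat.filter_Ico_card_eq_of_periodic _ _ _ hA,
          Nat.count_eq_card_filter_range]
        exact disjoint_filter_filter (Finset.Ico_disjoint_Ico_consecutive _ _ _)
      have h2 := ih M (by omega)
      rw [h1]
      convert h2 using 2
      push_cast
      field_simp
      ring

/-- `p` divides `u * ((e * u) ^ 2 - 1)`. -/
abbrev HitsTwin (e p u : ℕ) : Prop := (u : ZMod p) * ((e * u : ZMod p) ^ 2 - 1) = 0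

theorem HitsTwin.periodic (e p : ℕ) : Function.Periodic (HitsTwin e p) p := by
  intro u
  simp [HitsTwin]

theorem card_filter_hitsTwin {e p : ℕ} (hp : p.Prime) (h2 : 2 ∣ e) :
    ((range p).filter (HitsTwin e p)).card = if p ∣ e then 1 else 3 := by
  have : Fact p.Prime := ⟨hp⟩
  have h1 : ((range p).filter (HitsTwin e p)).card
      = (univ.filter fun u : ZMod p => u * ((e * u) ^ 2 - 1) = 0).card := by
    refine Finset.card_bij' (fun u _ => (u : ZMod p)) (fun v _ => v.val) ?_ ?_ ?_ ?_
    · intro u hu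
      simp only [mem_filter, mem_univ, true_and] at hu ⊢
      exact hu.2
    · intro v hv
      simp only [mem_filter, mem_univ, true_and, mem_range, HitsTwin, ZMod.natCast_val] at hv ⊢
      refine ⟨ZMod.val_lt v, ?_⟩
      simpa using hv
    · intro u hu
      simp only [mem_filter, mem_range] at hu
      exact ZMod.val_cast_of_lt hu.1
    · intro v _
      simp
  rw [h1]
  split_ifs with h
  · have he : (e : ZMod p) = 0 := (ZMod.natCast_eq_zero_iff e p).2 h
    rw [Finset.card_eq_one]
    refine ⟨0, ?_⟩
    ext u
    simp [he]
  · have he : (e : ZMod p) ≠ 0 := fun h' => h ((ZMod.natCast_eq_zero_iff e p).1 h')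
    have hp2 : (2 : ZMod p) ≠ 0 := by
      intro h'
      have : ((2 : ℕ) : ZMod p) = 0 := by exact_mod_cast h'
      exact h (((ZMod.natCast_eq_zero_iff 2 p).1 this).trans h2)
    rw [Finset.card_eq_three]
    have hi : (e : ZMod p)⁻¹ ≠ 0 := inv_ne_zero he
    refine ⟨0, (e : ZMod p)⁻¹, -(e : ZMod p)⁻¹, hi.symm, (neg_ne_zero.2 hi).symm, ?_, ?_⟩
    · intro h'
      have : 2 * (e : ZMod p)⁻¹ = 0 := by linear_combination h'
      exact (mul_ne_zero hp2 hi) this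
    · ext u
      simp only [mem_filter, mem_univ, true_and, mem_insert, mem_singleton]
      have : u * ((e * u) ^ 2 - 1) = 0 ↔ u = 0 ∨ e * u = 1 ∨ e * u = -1 := by
        rw [show (e * u) ^ 2 - 1 = (e * u - 1) * (e * u + 1) by ring, mul_eq_zero, mul_eq_zero,
          sub_eq_zero, add_eq_zero_iff_eq_neg]
      rw [this, ← eq_inv_mul_iff_mul_eq₀ he, ← eq_inv_mul_iff_mul_eq₀ he, mul_one, mul_neg_one]

theorem sum_le_sum_of_injOn_of_le {α β : Type*} {s : Finset α} {t : Finset β} {f : α → ℝ}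
    {g : β → ℝ} (i : α → β) (hi : ∀ x ∈ s, i x ∈ t)
    (hinj : ∀ x ∈ s, ∀ y ∈ s, i x = i y → x = y) (hfg : ∀ x ∈ s, f x ≤ g (i x))
    (hg : ∀ y ∈ t, 0 ≤ g y) : ∑ x ∈ s, f x ≤ ∑ y ∈ t, g y := by
  classical
  calc ∑ x ∈ s, f x ≤ ∑ x ∈ s, g (i x) := Finset.sum_le_sum hfg
    _ = ∑ y ∈ s.image i, g y := (Finset.sum_image fun x hx y hy h => hinj x hx y hy h).symm
    _ ≤ _ := Finset.sum_le_sum_of_subset_of_nonneg (image_subset_iff.2 hi) fun y hy _ => hg y hy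

theorem sum_prod_mul_sum_prod_le_of_union {ι : Type*} [DecidableEq ι] {a b : ι → ℝ}
    (ha : ∀ i, 0 ≤ a i) (hb : ∀ i, 0 ≤ b i) {𝒜 ℬ 𝒮 : Finset (Finset ι)}
    (hu : ∀ S ∈ 𝒜, ∀ T ∈ ℬ, S ∪ T ∈ 𝒮) :
    (∑ S ∈ 𝒜, ∏ i ∈ S, a i) * (∑ T ∈ ℬ, ∏ i ∈ T, b i)
      ≤ ∑ S ∈ 𝒮, ∏ i ∈ S, (a i + b i + a i * b i) := by
  have hpa : ∀ S : Finset ι, 0 ≤ ∏ i ∈ S, a i := fun S => Finset.prod_nonneg fun i _ => ha i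
  have hpb : ∀ S : Finset ι, 0 ≤ ∏ i ∈ S, b i := fun S => Finset.prod_nonneg fun i _ => hb i
  have h1 : ∀ S ∈ 𝒮, ∏ i ∈ S, (a i + b i + a i * b i)
      = ∑ x ∈ S.powerset.sigma fun A => A.powerset,
        (∏ i ∈ x.1, a i) * ((∏ i ∈ x.2, b i) * ∏ i ∈ S \ x.1, b i) := by
    intro S _
    rw [Finset.sum_sigma]
    calc ∏ i ∈ S, (a i + b i + a i * b i) = ∏ i ∈ S, (a i * (1 + b i) + b i) :=
          Finset.prod_congr rfl fun i _ => by ring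
      _ = _ := by
        rw [Finset.prod_add]
        refine Finset.sum_congr rfl fun A _ => ?_
        rw [Finset.prod_mul_distrib, Finset.prod_one_add, mul_assoc, Finset.sum_mul,
          Finset.mul_sum]
  rw [Finset.sum_mul_sum, ← Finset.sum_product', Finset.sum_congr rfl h1,
    ← Finset.sum_fiberwise_of_maps_to (s := 𝒜 ×ˢ ℬ) (t := 𝒮) (g := fun x => x.1 ∪ x.2)
      fun x hx => hu _ (mem_product.1 hx).1 _ (mem_product.1 hx).2]
  refine Finset.sum_le_sum fun S _ => ?_
  refine sum_le_sum_of_injOn_of_le (fun x => ⟨x.1, x.1 ∩ x.2⟩) ?_ ?_ ?_ ?_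
  · intro x hx
    simp only [mem_filter] at hx
    simp only [mem_sigma, mem_powerset]
    exact ⟨hx.2 ▸ subset_union_left, inter_subset_left⟩
  · rintro ⟨A, B⟩ hx ⟨A', B'⟩ hy h
    simp only [mem_filter] at hx hy
    simp only [Sigma.mk.injEq, heq_eq_eq] at h
    obtain ⟨rfl, h2⟩ := h
    have e : ∀ B : Finset ι, B = (A ∩ B) ∪ ((A ∪ B) \ A) := by
      intro B; ext i; simp only [mem_union, mem_inter, mem_sdiff]; tauto
    rw [e B, e B', h2, hx.2, hy.2]
  · rintro ⟨A, B⟩ hx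
    simp only [mem_filter] at hx
    simp only
    have hd : Disjoint (A ∩ B) (S \ A) :=
      Finset.disjoint_sdiff.mono_left inter_subset_left
    rw [← Finset.prod_union hd]
    have : A ∩ B ∪ S \ A = B := by
      rw [← hx.2]; ext i; simp only [mem_union, mem_inter, mem_sdiff]; tauto
    rw [this]
  · intro x _
    exact mul_nonneg (hpa _) (mul_nonneg (hpb _) (hpb _))

/-- The subsets of `P` whose product is at most `n`. -/
def subsetsProdLE (P : Finset ℕ) (n : ℕ) : Finset (Finset ℕ) :=
  P.powerset.filter fun S => ∏ p ∈ S, p ≤ n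

theorem mem_subsetsProdLE {P : Finset ℕ} {n : ℕ} {S : Finset ℕ} :
    S ∈ subsetsProdLE P n ↔ S ⊆ P ∧ ∏ p ∈ S, p ≤ n := by
  simp [subsetsProdLE]

theorem union_mem_subsetsProdLE {P : Finset ℕ} (hP : ∀ p ∈ P, p.Prime) {m n : ℕ} {S T : Finset ℕ}
    (hS : S ∈ subsetsProdLE P m) (hT : T ∈ subsetsProdLE P n) :
    S ∪ T ∈ subsetsProdLE P (m * n) := by
  rw [mem_subsetsProdLE] at *
  refine ⟨union_subset hS.1 hT.1, ?_⟩
  calc ∏ p ∈ S ∪ T, p ≤ (∏ p ∈ S ∪ T, p) * ∏ p ∈ S ∩ T, p :=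
        Nat.le_mul_of_pos_right _ (Finset.prod_pos fun p hp =>
          (hP p (hS.1 (mem_inter.1 hp).1)).pos)
    _ = (∏ p ∈ S, p) * ∏ p ∈ T, p := Finset.prod_union_inter
    _ ≤ m * n := Nat.mul_le_mul hS.2 hT.2

theorem log_le_two_mul_sum_subsetsProdLE {P : Finset ℕ} {E : ℕ}
    (hP : ∀ p : ℕ, p.Prime → p ≤ E → p ∈ P) :
    Real.log (E + 1) ≤ 2 * ∑ S ∈ subsetsProdLE P E, ∏ p ∈ S, (p : ℝ)⁻¹ := by
  have h1 : Real.log (E + 1) ≤ ∑ n ∈ Icc 1 E, (n : ℝ)⁻¹ := by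
    have := log_add_one_le_harmonic E
    rw [harmonic_eq_sum_Icc] at this
    push_cast at this
    exact this
  have h2 : ∑ n ∈ Icc 1 E, (n : ℝ)⁻¹ ≤ ∑ x ∈ subsetsProdLE P E ×ˢ Ioo 0 (E + 1),
      (∏ p ∈ x.1, (p : ℝ)⁻¹) * ((x.2 : ℝ) ^ 2)⁻¹ := by
    have hex : ∀ n : ℕ, ∃ a b : ℕ, b ^ 2 * a = n ∧ Squarefree a := fun n => Nat.sq_mul_squarefree n
    choose a b hab hsq using hex
    have hprod : ∀ n, ∏ p ∈ (a n).primeFactors, p = a n := fun n =>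
      Nat.prod_primeFactors_of_squarefree (hsq n)
    refine sum_le_sum_of_injOn_of_le (fun n => ((a n).primeFactors, b n)) ?_ ?_ ?_ ?_
    · intro n hn
      rw [mem_Icc] at hn
      have hn0 : n ≠ 0 := by omega
      have hb : b n ≠ 0 := by
        intro h; apply hn0; rw [← hab n, h]; simp
      have ha : a n ≠ 0 := by
        intro h; apply hn0; rw [← hab n, h]; simp
      have han : a n ≤ n := by
        conv_rhs => rw [← hab n]
        exact Nat.le_mul_of_pos_left _ (by positivity)
      have hbn : b n ≤ n := by
        conv_rhs => rw [← hab n]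
        calc b n ≤ b n ^ 2 := Nat.le_self_pow (by norm_num) _
          _ ≤ _ := Nat.le_mul_of_pos_right _ (by positivity)
      rw [mem_product, mem_subsetsProdLE, mem_Ioo, hprod]
      refine ⟨⟨fun p hp => hP p (Nat.prime_of_mem_primeFactors hp) ?_, by omega⟩,
        by simp only; omega⟩
      exact (Nat.le_of_mem_primeFactors hp).trans (by omega)
    · intro n _ m _ h
      rw [Prod.mk.injEq] at h
      have ha : a n = a m := by rw [← hprod n, ← hprod m, h.1]
      rw [← hab n, ← hab m, ha, h.2]
    · intro n _
      have : (∏ p ∈ (a n).primeFactors, (p : ℝ)) = a n := by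
        rw [← Nat.cast_prod, hprod]
      rw [Finset.prod_inv_distrib, this, ← mul_inv]
      apply le_of_eq
      congr 1
      rw [mul_comm]
      exact_mod_cast (hab n).symm
    · intro x _
      positivity
  have h3 : ∑ b ∈ Ioo 0 (E + 1), ((b : ℝ) ^ 2)⁻¹ ≤ 2 := by
    have := sum_Ioo_inv_sq_le (α := ℝ) 0 (E + 1)
    simpa using this
  have h2' : ∑ n ∈ Icc 1 E, (n : ℝ)⁻¹ ≤ (∑ S ∈ subsetsProdLE P E, ∏ p ∈ S, (p : ℝ)⁻¹) *
      ∑ b ∈ Ioo 0 (E + 1), ((b : ℝ) ^ 2)⁻¹ := by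
    rw [Finset.sum_mul_sum, ← Finset.sum_product']
    exact h2
  have h4 : 0 ≤ ∑ S ∈ subsetsProdLE P E, ∏ p ∈ S, (p : ℝ)⁻¹ :=
    Finset.sum_nonneg fun S _ => Finset.prod_nonneg fun p _ => by positivity
  calc _ ≤ _ := h1.trans h2'
    _ ≤ _ := mul_le_mul_of_nonneg_left h3 h4
    _ = _ := mul_comm _ _

theorem sum_subsetsProdLE_le_mul_prod_primeFactors {P : Finset ℕ} (hP : ∀ p ∈ P, p.Prime)
    (E : ℕ) {e : ℕ} (he : e ≠ 0) :
    ∑ S ∈ subsetsProdLE P E, ∏ p ∈ S, (p : ℝ)⁻¹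
      ≤ (∑ S ∈ subsetsProdLE P E, ∏ p ∈ S, if p ∣ e then 0 else (p : ℝ)⁻¹) *
        ∏ p ∈ e.primeFactors, (1 + (p : ℝ)⁻¹) := by
  rw [Finset.prod_one_add, Finset.sum_mul_sum, ← Finset.sum_product']
  refine sum_le_sum_of_injOn_of_le (fun S => (S.filter (¬ · ∣ e), S.filter (· ∣ e))) ?_ ?_ ?_ ?_
  · intro S hS
    rw [mem_subsetsProdLE] at hS
    rw [mem_product, mem_subsetsProdLE, mem_powerset]
    refine ⟨⟨(filter_subset _ _).trans hS.1, ?_⟩, ?_⟩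
    · refine le_trans (Nat.le_of_dvd (Finset.prod_pos fun p hp => (hP p (hS.1 hp)).pos) ?_) hS.2
      exact Finset.prod_dvd_prod_of_subset _ _ _ (filter_subset _ _)
    · intro p hp
      rw [mem_filter] at hp
      exact Nat.mem_primeFactors.2 ⟨hP p (hS.1 hp.1), hp.2, he⟩
  · intro S _ T _ h
    rw [Prod.mk.injEq] at h
    rw [← Finset.filter_union_filter_not_eq (· ∣ e) S,
      ← Finset.filter_union_filter_not_eq (· ∣ e) T, h.1, h.2]
  · intro S _
    apply le_of_eq
    simp only
    rw [← Finset.prod_filter_mul_prod_filter_not S (· ∣ e), mul_comm]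
    congr 1
    refine Finset.prod_congr rfl fun p hp => ?_
    rw [if_neg (mem_filter.1 hp).2]
  · intro x _
    refine mul_nonneg (Finset.prod_nonneg fun p _ => ?_) (Finset.prod_nonneg fun p _ => ?_)
    · split_ifs <;> positivity
    · positivity

/-- The proportion of residue classes `u` modulo `p` with `p ∣ u * ((e * u) ^ 2 - 1)`. -/
noncomputable def twinDensity (e p : ℕ) : ℝ := (if p ∣ e then 1 else 3) / p

theorem twinDensity_pos (e : ℕ) {p : ℕ} (hp : p.Prime) : 0 < twinDensity e p := by
  have : (0 : ℝ) < p := by exact_mod_cast hp.pos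
  unfold twinDensity
  split_ifs <;> positivity

theorem five_le_of_not_dvd {e p : ℕ} (h6 : 6 ∣ e) (hp : p.Prime) (h : ¬ p ∣ e) : 5 ≤ p := by
  by_contra! hlt
  have := hp.two_le
  interval_cases p
  · exact h (dvd_trans (by norm_num) h6)
  · exact h (dvd_trans (by norm_num) h6)
  · exact absurd hp (by norm_num)

theorem one_sub_twinDensity_ge {e p : ℕ} (h6 : 6 ∣ e) (hp : p.Prime) :
    (p : ℝ)⁻¹ ≤ 1 - twinDensity e p := by
  have h2 : (2 : ℝ) ≤ p := by exact_mod_cast hp.two_le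
  unfold twinDensity
  rw [le_sub_iff_add_le, inv_eq_one_div, ← add_div, div_le_one (by linarith)]
  split_ifs with h
  · linarith
  · have : (5 : ℝ) ≤ p := by exact_mod_cast five_le_of_not_dvd h6 hp h
    linarith

theorem log_pow_three_le_selbergSum {P : Finset ℕ} (hP : ∀ p ∈ P, p.Prime) {E : ℕ}
    (hPE : ∀ p : ℕ, p.Prime → p ≤ E → p ∈ P) {e : ℕ} (h6 : 6 ∣ e) (he : e ≠ 0) :
    (Real.log (E + 1) / 2) ^ 3 ≤ (∑ S ∈ subsetsProdLE P (E * E * E),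
        ∏ p ∈ S, twinDensity e p / (1 - twinDensity e p)) *
      (∏ p ∈ e.primeFactors, (1 + (p : ℝ)⁻¹)) ^ 2 := by
  set a : ℕ → ℝ := fun p => (p : ℝ)⁻¹ with ha
  set b : ℕ → ℝ := fun p => if p ∣ e then 0 else (p : ℝ)⁻¹ with hb
  have ha0 : ∀ p, 0 ≤ a p := fun p => by simp only [ha]; positivity
  have hb0 : ∀ p, 0 ≤ b p := fun p => by simp only [hb]; split_ifs <;> positivity
  set Q := ∑ S ∈ subsetsProdLE P E, ∏ p ∈ S, a p with hQ
  set Q' := ∑ S ∈ subsetsProdLE P E, ∏ p ∈ S, b p with hQ'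
  set K := ∏ p ∈ e.primeFactors, (1 + (p : ℝ)⁻¹) with hK
  have hQ0 : 0 ≤ Q := Finset.sum_nonneg fun S _ => Finset.prod_nonneg fun p _ => ha0 p
  have hQ'0 : 0 ≤ Q' := Finset.sum_nonneg fun S _ => Finset.prod_nonneg fun p _ => hb0 p
  have hK0 : 0 ≤ K := Finset.prod_nonneg fun p _ => by positivity
  have h1 : Real.log (E + 1) / 2 ≤ Q := by
    have := log_le_two_mul_sum_subsetsProdLE hPE
    linarith
  have h2 : Q ≤ Q' * K := sum_subsetsProdLE_le_mul_prod_primeFactors hP E he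
  have hlog : 0 ≤ Real.log (E + 1) / 2 :=
    div_nonneg (Real.log_nonneg (by norm_cast; omega)) (by norm_num)
  have h3 : Q * Q' * Q' ≤ ∑ S ∈ subsetsProdLE P (E * E * E),
        ∏ p ∈ S, twinDensity e p / (1 - twinDensity e p) := by
    have h4 : Q * Q' ≤ ∑ S ∈ subsetsProdLE P (E * E), ∏ p ∈ S, (a p + b p + a p * b p) :=
      sum_prod_mul_sum_prod_le_of_union ha0 hb0
        fun S hS T hT => union_mem_subsetsProdLE hP hS hT
    refine (mul_le_mul_of_nonneg_right h4 hQ'0).trans ?_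
    refine (sum_prod_mul_sum_prod_le_of_union
      (fun p => by have := ha0 p; have := hb0 p; positivity) hb0
        fun S hS T hT => union_mem_subsetsProdLE hP hS hT).trans ?_
    refine Finset.sum_le_sum fun S hS => Finset.prod_le_prod
      (fun p _ => by have := ha0 p; have := hb0 p; positivity) fun p hp => ?_
    have hpp := hP p ((mem_subsetsProdLE.1 hS).1 hp)
    have hge := one_sub_twinDensity_ge h6 hpp
    have h2 : (2 : ℝ) ≤ p := by exact_mod_cast hpp.two_le
    have hpos : (0 : ℝ) < (p : ℝ)⁻¹ := by positivity
    rw [le_div_iff₀ (by linarith)]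
    simp only [ha, hb]
    unfold twinDensity
    split_ifs with h
    · rw [one_div]; nlinarith
    · have : (5 : ℝ) ≤ p := by exact_mod_cast five_le_of_not_dvd h6 hpp h
      rw [div_eq_mul_inv]
      set t := (p : ℝ)⁻¹
      have h8 : 0 ≤ t ^ 2 := by positivity
      have h9 : 0 ≤ t ^ 3 := by positivity
      have h10 : 0 ≤ t ^ 4 := by positivity
      nlinarith
  calc (Real.log (E + 1) / 2) ^ 3 ≤ Q ^ 3 := by gcongr
    _ = Q * Q * Q := by ring
    _ ≤ Q * (Q' * K) * (Q' * K) := by gcongr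
    _ = Q * Q' * Q' * K ^ 2 := by ring
    _ ≤ _ := by gcongr

theorem not_hitsTwin {e p u : ℕ} (hp : p.Prime) (he : 0 < e) (hpu : ¬ p ∣ u)
    (h1 : (e * u - 1).Prime) (h2 : (e * u + 1).Prime) (hlt : p < e * u - 1) :
    ¬ HitsTwin e p u := by
  have : Fact p.Prime := ⟨hp⟩
  have hu : 0 < u := Nat.pos_of_ne_zero (by rintro rfl; exact hpu (dvd_zero p))
  have heu : 1 ≤ e * u := Nat.mul_pos he hu
  intro h
  have h' : (u : ZMod p) * (((e * u - 1 : ℕ) : ZMod p) * ((e * u + 1 : ℕ) : ZMod p)) = 0 := by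
    rw [← h]
    push_cast [heu]
    ring
  rw [mul_eq_zero, mul_eq_zero, ZMod.natCast_eq_zero_iff, ZMod.natCast_eq_zero_iff,
    ZMod.natCast_eq_zero_iff] at h'
  rcases h' with h' | h' | h'
  · exact hpu h'
  · rw [Nat.prime_dvd_prime_iff_eq hp h1] at h'
    omega
  · rw [Nat.prime_dvd_prime_iff_eq hp h2] at h'
    omega

theorem card_subsetsProdLE_le {P : Finset ℕ} (hP : ∀ p ∈ P, p.Prime) (n : ℕ) :
    (subsetsProdLE P n).card ≤ n := by
  calc _ ≤ (Icc 1 n).card := by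
        refine Finset.card_le_card_of_injOn (fun S => ∏ p ∈ S, p) ?_ ?_
        · intro S hS
          rw [mem_coe, mem_subsetsProdLE] at hS
          rw [mem_coe, mem_Icc]
          exact ⟨Finset.prod_pos fun p hp => (hP p (hS.1 hp)).pos, hS.2⟩
        · intro S hS T hT h
          rw [mem_coe, mem_subsetsProdLE] at hS hT
          rw [← Nat.primeFactors_prod fun p hp => hP p (hS.1 hp),
            ← Nat.primeFactors_prod fun p hp => hP p (hT.1 hp)]
          exact congrArg Nat.primeFactors h
    _ = n := by simp

theorem card_sifted_twin_le {P : Finset ℕ} (hP : ∀ p ∈ P, p.Prime) {E : ℕ} (hE : 1 ≤ E)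
    (hPE : ∀ p : ℕ, p.Prime → p ≤ E → p ∈ P) {e : ℕ} (h6 : 6 ∣ e) (he : e ≠ 0) (N : ℕ) :
    (((Ico 1 (N + 1)).filter fun u => ∀ p ∈ P, ¬ HitsTwin e p u).card : ℝ)
      ≤ N * ((∏ p ∈ e.primeFactors, (1 + (p : ℝ)⁻¹)) ^ 2 * (2 / Real.log (E + 1)) ^ 3)
        + (E : ℝ) ^ 18 := by
  set D := subsetsProdLE P (E * E * E) with hD
  have hDP : ∀ S ∈ D, S ⊆ P := fun S hS => (mem_subsetsProdLE.1 hS).1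
  have hE3 : 1 ≤ E * E * E := Nat.mul_pos (Nat.mul_pos hE hE) hE
  have hg0 : ∀ p ∈ P, 0 < twinDensity e p := fun p hp => twinDensity_pos e (hP p hp)
  have hinv : ∀ p ∈ P, (0 : ℝ) < (p : ℝ)⁻¹ := fun p hp => by
    have : (0 : ℝ) < p := by exact_mod_cast (hP p hp).pos
    positivity
  have hg1 : ∀ p ∈ P, twinDensity e p < 1 := fun p hp => by
    have := one_sub_twinDensity_ge h6 (hP p hp)
    have := hinv p hp
    linarith
  have hne : ∅ ∈ D := by
    rw [hD, mem_subsetsProdLE]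
    exact ⟨empty_subset _, by simpa using hE3⟩
  have hdown : ∀ S ∈ D, ∀ T ⊆ S, T ∈ D := by
    intro S hS T hT
    rw [hD, mem_subsetsProdLE] at hS ⊢
    refine ⟨hT.trans hS.1, le_trans (Nat.le_of_dvd ?_ ?_) hS.2⟩
    · exact Finset.prod_pos fun p hp => (hP p (hS.1 hp)).pos
    · exact Finset.prod_dvd_prod_of_subset _ _ _ hT
  have h2e : 2 ∣ e := dvd_trans (by norm_num) h6
  have key := selberg_sieve (P := P) (g := twinDensity e) (D := D) (Ico 1 (N + 1)) (HitsTwin e)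
    hg0 hg1 hDP hne hdown N ((E * E * E * (E * E * E) : ℕ) : ℝ) ((E * E * E : ℕ) : ℝ) ?_ ?_
  · refine key.trans (add_le_add ?_ ?_)
    · refine mul_le_mul_of_nonneg_left ?_ (Nat.cast_nonneg N)
      have h1 := log_pow_three_le_selbergSum hP hPE h6 he
      have hG := selbergSum_pos hg0 hg1 hDP hne
      rw [← hD] at h1
      have hlog : 0 < Real.log (E + 1) := Real.log_pos (by
        have : (1 : ℝ) ≤ E := by exact_mod_cast hE
        linarith)
      rw [inv_eq_one_div, div_le_iff₀ hG]
      have h2 : (2 / Real.log (E + 1)) ^ 3 * (Real.log (E + 1) / 2) ^ 3 = 1 := by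
        rw [← mul_pow]; field_simp
      calc (1 : ℝ) = (2 / Real.log (E + 1)) ^ 3 * (Real.log (E + 1) / 2) ^ 3 := h2.symm
        _ ≤ (2 / Real.log (E + 1)) ^ 3 * _ := mul_le_mul_of_nonneg_left h1 (by positivity)
        _ = _ := by ring
    · have hc : (D.card : ℝ) ≤ ((E * E * E : ℕ) : ℝ) := by
        exact_mod_cast card_subsetsProdLE_le hP _
      calc _ ≤ ((E * E * E * (E * E * E) : ℕ) : ℝ) *
            (((E * E * E : ℕ) : ℝ) * ((E * E * E : ℕ) : ℝ)) ^ 2 := by gcongr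
        _ = (E : ℝ) ^ 18 := by push_cast; ring
  · intro S hS T hT
    have hST : ∀ p ∈ S ∪ T, p.Prime := fun p hp =>
      hP p (union_subset (hDP S hS) (hDP T hT) hp)
    have hper : ∀ p ∈ S ∪ T, Function.Periodic (HitsTwin e p) p :=
      fun p _ => HitsTwin.periodic e p
    have h1 := abs_card_filter_Ico_sub_le_of_periodic
      (Finset.prod_pos fun p hp => (hST p hp).pos) (periodic_forall_mem hper) N
    rw [card_filter_range_prod_of_periodic hST hper] at h1
    have h2 : ((∏ p ∈ S ∪ T, ((range p).filter (HitsTwin e p)).card : ℕ) : ℝ) /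
        ((∏ p ∈ S ∪ T, p : ℕ) : ℝ) = ∏ p ∈ S ∪ T, twinDensity e p := by
      rw [Nat.cast_prod, Nat.cast_prod, ← Finset.prod_div_distrib]
      refine Finset.prod_congr rfl fun p hp => ?_
      rw [card_filter_hitsTwin (hST p hp) h2e]
      unfold twinDensity
      split_ifs <;> simp
    rw [h2] at h1
    refine h1.trans ?_
    exact_mod_cast (mem_subsetsProdLE.1 (union_mem_subsetsProdLE hP hS hT)).2
  · intro S hS
    calc ∏ p ∈ S, (1 - twinDensity e p)⁻¹ ≤ ∏ p ∈ S, (p : ℝ) := by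
          refine Finset.prod_le_prod (fun p hp => ?_) fun p hp => ?_
          · exact inv_nonneg.2 (sub_nonneg.2 (hg1 p (hDP S hS hp)).le)
          · rw [inv_le_comm₀ (sub_pos.2 (hg1 p (hDP S hS hp)))
              (by exact_mod_cast (hP p (hDP S hS hp)).pos)]
            exact one_sub_twinDensity_ge h6 (hP p (hDP S hS hp))
      _ ≤ _ := by
          rw [← Nat.cast_prod]
          exact_mod_cast (mem_subsetsProdLE.1 hS).2

theorem card_primePow_twin_le {E : ℕ} (hE : 1 ≤ E) {e : ℕ} (h6 : 6 ∣ e) (he : e ≠ 0) (N : ℕ) :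
    (((Icc 1 N).filter fun u => IsPrimePow u ∧ (e * u - 1).Prime ∧ (e * u + 1).Prime).card : ℝ)
      ≤ N * ((∏ p ∈ e.primeFactors, (1 + (p : ℝ)⁻¹)) ^ 2 * (2 / Real.log (E + 1)) ^ 3)
        + (E : ℝ) ^ 18 + E * (Nat.log 2 N + 1) := by
  set P := (Icc 1 E).filter Nat.Prime with hPdef
  have hP : ∀ p ∈ P, p.Prime := fun p hp => (mem_filter.1 hp).2
  have hPE : ∀ p : ℕ, p.Prime → p ≤ E → p ∈ P := fun p hp hpE =>
    mem_filter.2 ⟨mem_Icc.2 ⟨hp.one_le, hpE⟩, hp⟩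
  have hsub : ((Icc 1 N).filter fun u => IsPrimePow u ∧ (e * u - 1).Prime ∧ (e * u + 1).Prime)
      ⊆ ((Ico 1 (N + 1)).filter fun u => ∀ p ∈ P, ¬ HitsTwin e p u) ∪
        (Icc 1 E ×ˢ range (Nat.log 2 N + 1)).image fun x => x.1 ^ x.2 := by
    intro u hu
    rw [mem_filter, mem_Icc] at hu
    obtain ⟨⟨hu1, huN⟩, hpow, hm, hp⟩ := hu
    obtain ⟨q, a, hq, ha, rfl⟩ := (isPrimePow_nat_iff _).1 hpow
    rw [mem_union]
    by_cases hqE : q ≤ E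
    · right
      rw [mem_image]
      refine ⟨(q, a), ?_, rfl⟩
      rw [mem_product, mem_Icc, mem_range]
      refine ⟨⟨hq.one_le, hqE⟩, Nat.lt_succ_of_le ?_⟩
      refine Nat.le_log_of_pow_le (by norm_num) (le_trans ?_ huN)
      exact Nat.pow_le_pow_left hq.two_le a
    · left
      rw [mem_filter, mem_Ico]
      refine ⟨⟨hu1, by omega⟩, fun p hpP => ?_⟩
      rw [hPdef, mem_filter, mem_Icc] at hpP
      have hqq : q ≤ q ^ a := Nat.le_self_pow ha.ne' q
      have h6e : 6 * q ^ a ≤ e * q ^ a :=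
        Nat.mul_le_mul_right _ (Nat.le_of_dvd (Nat.pos_of_ne_zero he) h6)
      refine not_hitsTwin hpP.2 (Nat.pos_of_ne_zero he) ?_ hm hp (by omega)
      intro hdvd
      have := (Nat.prime_dvd_prime_iff_eq hpP.2 hq).1 (hpP.2.dvd_of_dvd_pow hdvd)
      omega
  have h1 := (card_le_card hsub).trans (card_union_le _ _)
  have h2 : ((Icc 1 E ×ˢ range (Nat.log 2 N + 1)).image fun x => x.1 ^ x.2).card
      ≤ E * (Nat.log 2 N + 1) := by
    refine card_image_le.trans ?_
    simp
  have h3 := card_sifted_twin_le hP hE hPE h6 he N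
  have h4 : (((Icc 1 N).filter fun u =>
      IsPrimePow u ∧ (e * u - 1).Prime ∧ (e * u + 1).Prime).card : ℝ)
      ≤ ((Ico 1 (N + 1)).filter fun u => ∀ p ∈ P, ¬ HitsTwin e p u).card +
        ((E * (Nat.log 2 N + 1) : ℕ) : ℝ) := by
    exact_mod_cast h1.trans (Nat.add_le_add_left h2 _)
  push_cast at h4
  linarith

/-- Uniform sieve bound for the prime powers `u ≤ Y` such that `e * u ± 1` are both prime. -/
theorem exists_card_primePow_twin_le :
    ∃ C : ℝ, 0 < C ∧ ∀ (Y : ℝ) (e : ℕ), 2 ≤ Y → 6 ∣ e → e ≠ 0 →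
      (((Icc 1 ⌊Y⌋₊).filter fun u =>
          IsPrimePow u ∧ (e * u - 1).Prime ∧ (e * u + 1).Prime).card : ℝ)
        ≤ C * (∏ p ∈ e.primeFactors, (1 + (p : ℝ)⁻¹)) ^ 2 * (Y / Real.log Y ^ 3) := by
  refine ⟨72 ^ 3 + 26 * 1728, by norm_num, fun Y e hY h6 he => ?_⟩
  have hY0 : 0 < Y := by linarith
  set s : ℝ := Y ^ (1 / 36 : ℝ) with hs
  have hs36 : s ^ 36 = Y := by
    rw [hs, ← Real.rpow_natCast, ← Real.rpow_mul hY0.le]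
    norm_num
  have hs1 : 1 ≤ s := Real.one_le_rpow (by linarith) (by norm_num)
  have hlogs : Real.log Y ≤ 12 * s ^ 3 := by
    have h := Real.log_le_rpow_div hY0.le (show (0 : ℝ) < 1 / 12 by norm_num)
    have h' : s ^ 3 = Y ^ (1 / 12 : ℝ) := by
      rw [hs, ← Real.rpow_natCast, ← Real.rpow_mul hY0.le]
      norm_num
    rw [h']
    linarith
  have hlog : 0 < Real.log Y := Real.log_pos (by linarith)
  set E := ⌊s⌋₊ with hEdef
  have hE1 : 1 ≤ E := Nat.one_le_floor_iff _ |>.2 hs1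
  have hEs : (E : ℝ) ≤ s := Nat.floor_le (by linarith)
  have hE2 : Real.log Y / 36 ≤ Real.log (E + 1) := by
    have h : Real.log s = Real.log Y / 36 := by
      rw [hs, Real.log_rpow hY0]; ring
    rw [← h]
    exact Real.log_le_log (by linarith) (Nat.lt_floor_add_one s).le
  have hN : (⌊Y⌋₊ : ℝ) ≤ Y := Nat.floor_le hY0.le
  have hlogN : (Nat.log 2 ⌊Y⌋₊ : ℝ) ≤ 2 * Real.log Y := by
    have h1 : 2 ^ Nat.log 2 ⌊Y⌋₊ ≤ ⌊Y⌋₊ :=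
      Nat.pow_log_le_self 2 (Nat.floor_pos.2 (by linarith)).ne'
    have h2 : (2 : ℝ) ^ Nat.log 2 ⌊Y⌋₊ ≤ Y := le_trans (by exact_mod_cast h1) hN
    have h3 := Real.log_le_log (by positivity) h2
    rw [Real.log_pow] at h3
    have h4 := Real.log_two_gt_d9
    have h5 : (0 : ℝ) ≤ Nat.log 2 ⌊Y⌋₊ := by positivity
    nlinarith
  have hK1 : 1 ≤ ∏ p ∈ e.primeFactors, (1 + (p : ℝ)⁻¹) := by
    calc (1 : ℝ) = ∏ _p ∈ e.primeFactors, (1 : ℝ) := by simp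
      _ ≤ _ := Finset.prod_le_prod (fun _ _ => zero_le_one) fun p _ =>
          le_add_of_nonneg_right (by positivity)
  have main := card_primePow_twin_le hE1 h6 he ⌊Y⌋₊
  set K := ∏ p ∈ e.primeFactors, (1 + (p : ℝ)⁻¹) with hK
  have h1 : (⌊Y⌋₊ : ℝ) * (K ^ 2 * (2 / Real.log (E + 1)) ^ 3)
      ≤ 72 ^ 3 * K ^ 2 * (Y / Real.log Y ^ 3) := by
    have h2 : 2 / Real.log (E + 1) ≤ 72 / Real.log Y := by
      have : 2 / Real.log (E + 1) ≤ 2 / (Real.log Y / 36) := by gcongr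
      refine this.trans (le_of_eq ?_)
      field_simp
      norm_num
    have h0 : 0 ≤ 2 / Real.log (E + 1) :=
      div_nonneg (by norm_num) (le_trans (by positivity) hE2)
    calc _ ≤ Y * (K ^ 2 * (72 / Real.log Y) ^ 3) := by gcongr
      _ = _ := by rw [div_pow]; ring
  have h2 : (E : ℝ) ^ 18 + E * (Nat.log 2 ⌊Y⌋₊ + 1) ≤ 26 * s ^ 18 := by
    have h3 : (E : ℝ) ^ 18 ≤ s ^ 18 := by gcongr
    have h4 : (E : ℝ) * (Nat.log 2 ⌊Y⌋₊ + 1) ≤ s * (24 * s ^ 3 + s ^ 3) := by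
      have : 1 ≤ s ^ 3 := one_le_pow₀ hs1
      gcongr
      linarith
    have h5 : s ^ 4 ≤ s ^ 18 := pow_le_pow_right₀ hs1 (by norm_num)
    nlinarith
  have h3 : s ^ 18 ≤ 1728 * (Y / Real.log Y ^ 3) := by
    rw [← mul_div_assoc, le_div_iff₀ (by positivity)]
    calc s ^ 18 * Real.log Y ^ 3 ≤ s ^ 18 * (12 * s ^ 3) ^ 3 := by gcongr
      _ = 1728 * s ^ 27 := by ring
      _ ≤ 1728 * s ^ 36 := by
        have : s ^ 27 ≤ s ^ 36 := pow_le_pow_right₀ hs1 (by norm_num)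
        linarith
      _ = 1728 * Y := by rw [hs36]
  have hYl : 0 ≤ Y / Real.log Y ^ 3 := by positivity
  have h4 : Y / Real.log Y ^ 3 ≤ K ^ 2 * (Y / Real.log Y ^ 3) :=
    le_mul_of_one_le_left hYl (one_le_pow₀ hK1)
  nlinarith

theorem sum_log_div_prime_le {N : ℕ} (hN : 1 ≤ N) :
    ∑ p ∈ Ioc 0 N with p.Prime, Real.log p / p ≤ Real.log N + Real.log 4 := by
  have hN0 : (0 : ℝ) < N := by exact_mod_cast hN
  have h1 : ∑ n ∈ Ioc 0 N, ∑ p ∈ Ioc 0 N with p.Prime, (if p ∣ n then Real.log p else 0)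
      ≤ N * Real.log N := by
    have : ∀ n ∈ Ioc 0 N, ∑ p ∈ Ioc 0 N with p.Prime, (if p ∣ n then Real.log p else 0)
        ≤ Real.log N := by
      intro n hn
      rw [mem_Ioc] at hn
      rw [← Finset.sum_filter]
      have h2 : ((Ioc 0 N).filter Nat.Prime).filter (· ∣ n) ⊆ n.primeFactors := by
        intro p hp
        simp only [mem_filter] at hp
        exact Nat.mem_primeFactors.2 ⟨hp.1.2, hp.2, by omega⟩
      calc _ ≤ ∑ p ∈ n.primeFactors, Real.log p :=
            Finset.sum_le_sum_of_subset_of_nonneg h2 fun p hp _ =>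
              Real.log_natCast_nonneg p
        _ = Real.log ((∏ p ∈ n.primeFactors, p : ℕ) : ℝ) := by
            rw [Nat.cast_prod, Real.log_prod]
            intro p hp
            exact_mod_cast (Nat.prime_of_mem_primeFactors hp).ne_zero
        _ ≤ Real.log N := by
            refine Real.log_le_log ?_ ?_
            · exact_mod_cast Finset.prod_pos fun p hp => (Nat.prime_of_mem_primeFactors hp).pos
            · exact_mod_cast (Nat.le_of_dvd hn.1 (Nat.prod_primeFactors_dvd n)).trans hn.2
    calc _ ≤ ∑ _n ∈ Ioc 0 N, Real.log N := Finset.sum_le_sum this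
      _ = N * Real.log N := by simp
  have h2 : ∑ n ∈ Ioc 0 N, ∑ p ∈ Ioc 0 N with p.Prime, (if p ∣ n then Real.log p else 0)
      = ∑ p ∈ Ioc 0 N with p.Prime, ((N / p : ℕ) : ℝ) * Real.log p := by
    rw [Finset.sum_comm]
    refine Finset.sum_congr rfl fun p _ => ?_
    rw [← Finset.sum_filter, Finset.sum_const, Nat.Ioc_filter_dvd_card_eq_div, nsmul_eq_mul]
  have h3 : ∑ p ∈ Ioc 0 N with p.Prime, ((N : ℝ) * (Real.log p / p) - Real.log p)
      ≤ ∑ p ∈ Ioc 0 N with p.Prime, ((N / p : ℕ) : ℝ) * Real.log p := by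
    refine Finset.sum_le_sum fun p hp => ?_
    have hlog : 0 ≤ Real.log p := Real.log_natCast_nonneg p
    have h4 : (N : ℝ) / p - 1 ≤ ((N / p : ℕ) : ℝ) := by
      have := Nat.lt_floor_add_one ((N : ℝ) / p)
      rw [Nat.floor_div_eq_div] at this
      linarith
    calc _ = ((N : ℝ) / p - 1) * Real.log p := by ring
      _ ≤ _ := mul_le_mul_of_nonneg_right h4 hlog
  rw [Finset.sum_sub_distrib, ← Finset.mul_sum] at h3
  have h5 : ∑ p ∈ Ioc 0 N with p.Prime, Real.log p ≤ Real.log 4 * N := by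
    have := Chebyshev.theta_le_log4_mul_x hN0.le
    rwa [Chebyshev.theta, Nat.floor_natCast] at this
  have h6 : (N : ℝ) * ∑ p ∈ Ioc 0 N with p.Prime, Real.log p / p
      ≤ N * (Real.log N + Real.log 4) := by
    rw [h2] at h1
    linarith
  exact le_of_mul_le_mul_left h6 hN0

theorem exists_sum_inv_prime_le :
    ∃ C : ℝ, ∀ N : ℕ, 2 ≤ N →
      ∑ p ∈ Ioc 0 N with p.Prime, (p : ℝ)⁻¹ ≤ Real.log (Real.log N) + C := by
  set A : ℕ → ℝ := fun N => ∑ p ∈ Ioc 0 N with p.Prime, Real.log p / p with hA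
  set c := Real.log 4 with hc
  have hc0 : 0 < c := Real.log_pos (by norm_num)
  have key : ∀ N : ℕ, 2 ≤ N → ∑ p ∈ Ioc 0 N with p.Prime, (p : ℝ)⁻¹
      ≤ A N / Real.log N + (Real.log (Real.log N) - Real.log (Real.log 2))
        + c * (1 / Real.log 2 - 1 / Real.log N) := by
    intro N hN
    induction N, hN using Nat.le_induction with
    | base =>
      have h : (Ioc 0 2).filter Nat.Prime = {2} := by decide
      have hl : Real.log 2 ≠ 0 := (Real.log_pos (by norm_num)).ne'
      simp only [hA, h, sum_singleton, Nat.cast_ofNat]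
      field_simp
      simp
    | succ N hN ih =>
      have hN2 : (2 : ℝ) ≤ N := by exact_mod_cast hN
      have hl1 : 0 < Real.log N := Real.log_pos (by linarith)
      have hl2 : 0 < Real.log (N + 1) := Real.log_pos (by linarith)
      have hl12 : Real.log N ≤ Real.log (N + 1) := Real.log_le_log (by linarith) (by linarith)
      have hstep : ∀ f : ℕ → ℝ, ∑ p ∈ Ioc 0 (N + 1) with p.Prime, f p
          = ∑ p ∈ Ioc 0 N with p.Prime, f p + if (N + 1).Prime then f (N + 1) else 0 := by
        intro f
        rw [Finset.sum_filter, Finset.sum_filter, Finset.sum_Ioc_succ_top (by omega)]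
      have hAs : A (N + 1) / Real.log (N + 1) = A N / Real.log (N + 1)
          + if (N + 1).Prime then ((N + 1 : ℕ) : ℝ)⁻¹ else 0 := by
        simp only [hA]
        rw [hstep, add_div]
        congr 1
        split_ifs
        · push_cast
          field_simp
        · simp
      have hAle : A N ≤ Real.log N + c := sum_log_div_prime_le (by omega)
      have hd : 0 ≤ 1 / Real.log N - 1 / Real.log (N + 1) :=
        sub_nonneg.2 (one_div_le_one_div_of_le hl1 hl12)
      have h1 : A N / Real.log N - A N / Real.log (N + 1)
          ≤ (1 - Real.log N / Real.log (N + 1))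
            + c * (1 / Real.log N - 1 / Real.log (N + 1)) := by
        calc _ = A N * (1 / Real.log N - 1 / Real.log (N + 1)) := by ring
          _ ≤ (Real.log N + c) * (1 / Real.log N - 1 / Real.log (N + 1)) :=
            mul_le_mul_of_nonneg_right hAle hd
          _ = _ := by field_simp
      have h2 : 1 - Real.log N / Real.log (N + 1)
          ≤ Real.log (Real.log (N + 1)) - Real.log (Real.log N) := by
        have := Real.log_le_sub_one_of_pos (div_pos hl1 hl2)
        rw [Real.log_div hl1.ne' hl2.ne'] at this
        linarith
      rw [hstep]
      push_cast at hAs ⊢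
      rw [hAs]
      linarith
  refine ⟨1 + 2 * (c / Real.log 2) - Real.log (Real.log 2), fun N hN => ?_⟩
  have hN2 : (2 : ℝ) ≤ N := by exact_mod_cast hN
  have hl2 : 0 < Real.log 2 := Real.log_pos (by norm_num)
  have hl : 0 < Real.log N := Real.log_pos (by linarith)
  have h1 : A N / Real.log N ≤ 1 + c / Real.log 2 := by
    calc _ ≤ (Real.log N + c) / Real.log N := by
          gcongr; exact sum_log_div_prime_le (by omega)
      _ = 1 + c / Real.log N := by field_simp
      _ ≤ _ := by gcongr
  have h2 : c * (1 / Real.log 2 - 1 / Real.log N) ≤ c / Real.log 2 := by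
    have : 0 ≤ c * (1 / Real.log N) := by positivity
    calc _ = c / Real.log 2 - c * (1 / Real.log N) := by ring
      _ ≤ _ := by linarith
  have := key N hN
  linarith

theorem factorial_mul_sum_primeFactors_card_eq_le {w : ℕ → ℕ → ℝ} (hw : ∀ p a, 0 ≤ w p a)
    {P : Finset ℕ} {M : ℕ} {D : Finset ℕ} (hD0 : ∀ d ∈ D, d ≠ 0)
    (hDP : ∀ d ∈ D, d.primeFactors ⊆ P) (hDM : ∀ d ∈ D, ∀ p, d.factorization p ≤ M)
    (hDc : ∀ d ∈ D, ∀ p ∈ d.primeFactors, ordCompl[p] d ∈ D) (r : ℕ) :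
    (r.factorial : ℝ) * ∑ d ∈ D with d.primeFactors.card = r,
        ∏ p ∈ d.primeFactors, w p (d.factorization p)
      ≤ (∑ p ∈ P, ∑ a ∈ Icc 1 M, w p a) ^ r := by
  have hW : ∀ d : ℕ, 0 ≤ ∏ p ∈ d.primeFactors, w p (d.factorization p) := fun d =>
    Finset.prod_nonneg fun p _ => hw _ _
  induction r with
  | zero =>
    have h1 : ∑ d ∈ D with d.primeFactors.card = 0,
        ∏ p ∈ d.primeFactors, w p (d.factorization p) ≤ ∑ d ∈ ({1} : Finset ℕ), 1 := by
      refine sum_le_sum_of_injOn_of_le id ?_ (fun x _ y _ h => h) ?_ (fun _ _ => zero_le_one)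
      · intro d hd
        rw [mem_filter, card_eq_zero, Nat.primeFactors_eq_empty] at hd
        have := hD0 d hd.1
        simp only [id, mem_singleton]
        tauto
      · intro d hd
        rw [mem_filter, card_eq_zero] at hd
        rw [hd.2, prod_empty]
    simpa using h1
  | succ r ih =>
    have h1 : ((r : ℝ) + 1) * ∑ d ∈ D with d.primeFactors.card = r + 1,
        ∏ p ∈ d.primeFactors, w p (d.factorization p)
        = ∑ x ∈ (D.filter fun d => d.primeFactors.card = r + 1).sigma fun d => d.primeFactors,
            ∏ p ∈ x.1.primeFactors, w p (x.1.factorization p) := by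
      rw [Finset.sum_sigma, Finset.mul_sum]
      refine Finset.sum_congr rfl fun d hd => ?_
      dsimp only
      rw [Finset.sum_const, (mem_filter.1 hd).2, nsmul_eq_mul]
      push_cast
      ring
    have h2 : ∑ x ∈ (D.filter fun d => d.primeFactors.card = r + 1).sigma fun d => d.primeFactors,
            ∏ p ∈ x.1.primeFactors, w p (x.1.factorization p)
        ≤ ∑ y ∈ (P ×ˢ Icc 1 M) ×ˢ (D.filter fun d => d.primeFactors.card = r),
            w y.1.1 y.1.2 * ∏ p ∈ y.2.primeFactors, w p (y.2.factorization p) := by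
      have hpf : ∀ d p, (ordCompl[p] d).primeFactors = d.primeFactors.erase p := by
        intro d p
        rw [← Nat.support_factorization, Nat.factorization_ordCompl, Finsupp.support_erase,
          Nat.support_factorization]
      refine sum_le_sum_of_injOn_of_le
        (fun x => ((x.2, x.1.factorization x.2), ordCompl[x.2] x.1)) ?_ ?_ ?_ ?_
      · rintro ⟨d, p⟩ hx
        simp only [mem_sigma, mem_filter] at hx
        obtain ⟨⟨hd, hc⟩, hp⟩ := hx
        simp only [mem_product, mem_filter, mem_Icc]
        refine ⟨⟨hDP d hd hp, ?_, hDM d hd p⟩, hDc d hd p hp, ?_⟩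
        · exact (Nat.prime_of_mem_primeFactors hp).factorization_pos_of_dvd (hD0 d hd)
            (Nat.dvd_of_mem_primeFactors hp)
        · rw [hpf, card_erase_of_mem hp, hc]; rfl
      · rintro ⟨d, p⟩ _ ⟨d', p'⟩ _ h
        simp only [Prod.mk.injEq] at h
        obtain ⟨⟨rfl, h2⟩, h3⟩ := h
        have : d = d' := by
          rw [← Nat.ordProj_mul_ordCompl_eq_self d p, ← Nat.ordProj_mul_ordCompl_eq_self d' p,
            h3, h2]
        rw [this]
      · rintro ⟨d, p⟩ hx
        simp only [mem_sigma, mem_filter] at hx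
        apply le_of_eq
        simp only [hpf]
        rw [← Finset.mul_prod_erase _ _ hx.2]
        congr 1
        refine Finset.prod_congr rfl fun q hq => ?_
        rw [Nat.factorization_ordCompl, Finsupp.erase_ne (mem_erase.1 hq).1]
      · intro y _
        exact mul_nonneg (hw _ _) (hW _)
    have h3 : ∑ y ∈ (P ×ˢ Icc 1 M) ×ˢ (D.filter fun d => d.primeFactors.card = r),
            w y.1.1 y.1.2 * ∏ p ∈ y.2.primeFactors, w p (y.2.factorization p)
        = (∑ p ∈ P, ∑ a ∈ Icc 1 M, w p a) * ∑ d ∈ D with d.primeFactors.card = r,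
            ∏ p ∈ d.primeFactors, w p (d.factorization p) := by
      rw [← Finset.sum_product' (f := fun p a => w p a), Finset.sum_mul_sum,
        ← Finset.sum_product']
    have hS : 0 ≤ ∑ p ∈ P, ∑ a ∈ Icc 1 M, w p a :=
      Finset.sum_nonneg fun p _ => Finset.sum_nonneg fun a _ => hw p a
    rw [h3, ← h1] at h2
    rw [Nat.factorial_succ, pow_succ]
    push_cast
    calc _ = (r.factorial : ℝ) * (((r : ℝ) + 1) * ∑ d ∈ D with d.primeFactors.card = r + 1,
          ∏ p ∈ d.primeFactors, w p (d.factorization p)) := by ring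
      _ ≤ r.factorial * _ := mul_le_mul_of_nonneg_left h2 (by positivity)
      _ = (r.factorial * ∑ d ∈ D with d.primeFactors.card = r,
            ∏ p ∈ d.primeFactors, w p (d.factorization p)) *
          (∑ p ∈ P, ∑ a ∈ Icc 1 M, w p a) := by ring
      _ ≤ _ := mul_le_mul_of_nonneg_right ih hS

/-- The local weights of `d ↦ ∏ p ∣ d, (1 + 1 / p) ^ 2 * d ^ (δ - 1)`. -/
noncomputable def rankinWeight (δ : ℝ) (p a : ℕ) : ℝ :=
  (1 + (p : ℝ)⁻¹) ^ 2 * ((p : ℝ) ^ (δ - 1)) ^ a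

theorem rankinWeight_nonneg (δ : ℝ) (p a : ℕ) : 0 ≤ rankinWeight δ p a := by
  unfold rankinWeight
  positivity

theorem prod_rankinWeight (δ : ℝ) {d : ℕ} (hd : d ≠ 0) :
    ∏ p ∈ d.primeFactors, rankinWeight δ p (d.factorization p)
      = (∏ p ∈ d.primeFactors, (1 + (p : ℝ)⁻¹)) ^ 2 * (d : ℝ) ^ (δ - 1) := by
  unfold rankinWeight
  rw [Finset.prod_mul_distrib, Finset.prod_pow]
  congr 1
  have h : (d : ℝ) = ∏ p ∈ d.primeFactors, (p : ℝ) ^ d.factorization p := by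
    conv_lhs => rw [← Nat.prod_factorization_pow_eq_self hd]
    rw [Finsupp.prod, Nat.support_factorization]
    push_cast
    rfl
  rw [h, ← Real.finsetProd_rpow _ _ fun p _ => by positivity]
  refine Finset.prod_congr rfl fun p _ => ?_
  rw [← Real.rpow_natCast, ← Real.rpow_natCast, ← Real.rpow_mul (by positivity),
    ← Real.rpow_mul (by positivity), mul_comm]

theorem sum_rankinWeight_le {δ : ℝ} (hδ0 : 0 ≤ δ) (hδ : δ ≤ 1 / 4) {p : ℕ} (hp : p.Prime)
    (hδp : δ * Real.log p ≤ 1) (M : ℕ) :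
    ∑ a ∈ Icc 1 M, rankinWeight δ p a
      ≤ (p : ℝ)⁻¹ + 3 * δ * (Real.log p / p) + 10 * (p : ℝ) ^ (-(3 / 2) : ℝ) := by
  have hp2 : (2 : ℝ) ≤ p := by exact_mod_cast hp.two_le
  have hp0 : (0 : ℝ) < p := by linarith
  set t : ℝ := (p : ℝ) ^ (δ - 1) with ht
  have ht0 : 0 < t := by positivity
  have ht1 : t ≤ 3 / 5 := by
    calc t ≤ (p : ℝ) ^ (-(3 / 4) : ℝ) :=
          Real.rpow_le_rpow_of_exponent_le (by linarith) (by linarith)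
      _ ≤ (2 : ℝ) ^ (-(3 / 4) : ℝ) :=
          Real.rpow_le_rpow_of_nonpos (by norm_num) hp2 (by norm_num)
      _ ≤ 3 / 5 := by
          have h4 : ((2 : ℝ) ^ (-(3 / 4) : ℝ)) ^ 4 = 1 / 8 := by
            rw [← Real.rpow_natCast, ← Real.rpow_mul (by norm_num)]
            norm_num
          by_contra! h
          have : (3 / 5 : ℝ) ^ 4 < ((2 : ℝ) ^ (-(3 / 4) : ℝ)) ^ 4 := by gcongr
          rw [h4] at this
          norm_num at this
  have ht2 : t ^ 2 ≤ (p : ℝ) ^ (-(3 / 2) : ℝ) := by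
    rw [ht, ← Real.rpow_natCast, ← Real.rpow_mul hp0.le]
    exact Real.rpow_le_rpow_of_exponent_le (by linarith) (by push_cast; linarith)
  have htp : t * (p : ℝ)⁻¹ ≤ (p : ℝ) ^ (-(3 / 2) : ℝ) := by
    rw [ht, ← Real.rpow_neg_one, ← Real.rpow_add hp0]
    exact Real.rpow_le_rpow_of_exponent_le (by linarith) (by linarith)
  have htt : t ≤ (p : ℝ)⁻¹ + 3 * δ * (Real.log p / p) := by
    have h1 : t = Real.exp (δ * Real.log p) * (p : ℝ)⁻¹ := by
      rw [ht, Real.rpow_sub_one hp0.ne', Real.rpow_def_of_pos hp0, div_eq_mul_inv, mul_comm δ]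
    set v := δ * Real.log p with hv
    have hv0 : 0 ≤ v := mul_nonneg hδ0 (Real.log_natCast_nonneg p)
    have h2 : Real.exp v ≤ 1 + 3 * v := by
      have h3 := Real.one_sub_le_exp_neg v
      have h4 : Real.exp v ≤ 3 := by
        calc Real.exp v ≤ Real.exp 1 := Real.exp_le_exp.2 hδp
          _ ≤ 3 := by have := Real.exp_one_lt_d9; linarith
      have h5 : Real.exp v * Real.exp (-v) = 1 := by rw [← Real.exp_add]; simp
      have h6 := Real.exp_pos v
      nlinarith
    rw [h1]
    calc _ ≤ (1 + 3 * v) * (p : ℝ)⁻¹ := by gcongr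
      _ = _ := by rw [hv]; ring
  have hgeom : ∑ a ∈ Icc 1 M, t ^ a ≤ t + 5 / 2 * t ^ 2 := by
    have h1 : ∀ M : ℕ, ∑ a ∈ Icc 1 M, t ^ a ≤ (t - t ^ (M + 1)) / (1 - t) := by
      intro M
      rw [le_div_iff₀ (by linarith)]
      apply le_of_eq
      induction M with
      | zero => simp
      | succ n ih =>
        rw [Finset.sum_Icc_succ_top (by omega), add_mul, ih]
        ring
    have h2 : 0 < t ^ (M + 1) := by positivity
    refine (h1 M).trans ?_
    rw [div_le_iff₀ (by linarith)]
    nlinarith [pow_pos ht0 2, pow_pos ht0 3]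
  unfold rankinWeight
  rw [← Finset.mul_sum]
  have hi0 : 0 < (p : ℝ)⁻¹ := by positivity
  have hi : (p : ℝ)⁻¹ ≤ 1 / 2 := by
    rw [inv_eq_one_div]; exact one_div_le_one_div_of_le (by norm_num) hp2
  set y := (p : ℝ)⁻¹ with hy
  have hq : (1 + y) ^ 2 ≤ 1 + 5 / 2 * y := by nlinarith
  have hq' : (1 + y) ^ 2 ≤ 9 / 4 := by nlinarith
  calc (1 + y) ^ 2 * ∑ a ∈ Icc 1 M, t ^ a ≤ (1 + y) ^ 2 * (t + 5 / 2 * t ^ 2) := by gcongr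
    _ = (1 + y) ^ 2 * t + 5 / 2 * ((1 + y) ^ 2 * t ^ 2) := by ring
    _ ≤ (1 + 5 / 2 * y) * t + 5 / 2 * (9 / 4 * t ^ 2) := by gcongr
    _ = t + 5 / 2 * (t * y) + 45 / 8 * t ^ 2 := by ring
    _ ≤ _ := by linarith [pow_pos ht0 2]

theorem exists_sum_rankinWeight_le :
    ∃ C : ℝ, ∀ (z M : ℕ) (δ : ℝ), 2 ≤ z → 0 ≤ δ → δ ≤ 1 / 4 → δ * Real.log z ≤ 1 →
      ∑ p ∈ Ioc 0 z with p.Prime, ∑ a ∈ Icc 1 M, rankinWeight δ p a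
        ≤ Real.log (Real.log z) + C := by
  obtain ⟨C, hC⟩ := exists_sum_inv_prime_le
  have hsum : Summable fun n : ℕ => (n : ℝ) ^ (-(3 / 2) : ℝ) :=
    Real.summable_nat_rpow.2 (by norm_num)
  refine ⟨C + 3 * (1 + Real.log 4) + 10 * ∑' n : ℕ, (n : ℝ) ^ (-(3 / 2) : ℝ),
    fun z M δ hz hδ0 hδ hδz => ?_⟩
  have h1 : ∑ p ∈ Ioc 0 z with p.Prime, ∑ a ∈ Icc 1 M, rankinWeight δ p a
      ≤ ∑ p ∈ Ioc 0 z with p.Prime,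
        ((p : ℝ)⁻¹ + 3 * δ * (Real.log p / p) + 10 * (p : ℝ) ^ (-(3 / 2) : ℝ)) := by
    refine Finset.sum_le_sum fun p hp => ?_
    rw [mem_filter, mem_Ioc] at hp
    refine sum_rankinWeight_le hδ0 hδ hp.2 (le_trans ?_ hδz) M
    have : Real.log p ≤ Real.log z :=
      Real.log_le_log (by exact_mod_cast hp.1.1) (by exact_mod_cast hp.1.2)
    gcongr
  rw [Finset.sum_add_distrib, Finset.sum_add_distrib, ← Finset.mul_sum, ← Finset.mul_sum] at h1
  have h2 := hC z hz
  have h3 : 3 * δ * ∑ p ∈ Ioc 0 z with p.Prime, Real.log p / p ≤ 3 * (1 + Real.log 4) := by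
    have h4 := sum_log_div_prime_le (N := z) (by omega)
    have hl4 : 0 ≤ Real.log 4 := Real.log_nonneg (by norm_num)
    calc _ ≤ 3 * δ * (Real.log z + Real.log 4) := by gcongr
      _ = 3 * (δ * Real.log z + δ * Real.log 4) := by ring
      _ ≤ _ := by nlinarith
  have h4 : ∑ p ∈ Ioc 0 z with p.Prime, (p : ℝ) ^ (-(3 / 2) : ℝ)
      ≤ ∑' n : ℕ, (n : ℝ) ^ (-(3 / 2) : ℝ) :=
    hsum.sum_le_tsum _ fun n _ => by positivity
  linarith

theorem six_dvd_of_prime_sub_one_of_prime_add_one {n : ℕ} (hn : 4 < n) (h1 : (n - 1).Prime)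
    (h2 : (n + 1).Prime) : 6 ∣ n := by
  have h3 : ¬ 2 ∣ n + 1 := fun h => by
    have := (Nat.prime_dvd_prime_iff_eq Nat.prime_two h2).1 h
    omega
  have h4 : ¬ 3 ∣ n + 1 := fun h => by
    have := (Nat.prime_dvd_prime_iff_eq Nat.prime_three h2).1 h
    omega
  have h5 : ¬ 3 ∣ n - 1 := fun h => by
    have := (Nat.prime_dvd_prime_iff_eq Nat.prime_three h1).1 h
    omega
  have h6 : n % 2 = 0 := by omega
  rcases (by omega : n % 3 = 0 ∨ n % 3 = 1 ∨ n % 3 = 2) with h | h | h <;> omega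

theorem card_twin_filter_le_sum (N : ℕ) {k : ℕ} (hk : 1 ≤ k) :
    ((Ioc 4 N).filter fun n =>
        (n - 1).Prime ∧ (n + 1).Prime ∧ (n / 6).primeFactors.card = k).card
      ≤ ∑ d ∈ (Icc 1 N).filter fun d =>
          d.primeFactors.card = k - 1 ∧ 2 * d ≤ N ∧ ∀ p ∈ d.primeFactors, p * d ≤ N,
        ((Icc 1 (N / d)).filter fun u =>
          IsPrimePow u ∧ (6 * d * u - 1).Prime ∧ (6 * d * u + 1).Prime).card := by
  rw [← Finset.card_sigma]
  set q : ℕ → ℕ := fun m => m.primeFactors.sup id with hq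
  refine Finset.card_le_card_of_injOn
    (fun n => ⟨ordCompl[q (n / 6)] (n / 6), ordProj[q (n / 6)] (n / 6)⟩) ?_ ?_
  · intro n hn
    simp only [coe_filter, Set.mem_ofPred_eq, mem_Ioc] at hn
    obtain ⟨⟨hn4, hnN⟩, hp1, hp2, hc⟩ := hn
    obtain ⟨m, rfl⟩ := six_dvd_of_prime_sub_one_of_prime_add_one hn4 hp1 hp2
    rw [Nat.mul_div_cancel_left m (by norm_num)] at hc
    simp only [Nat.mul_div_cancel_left m (show 0 < 6 by norm_num)]
    have hm0 : m ≠ 0 := by omega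
    have hne : m.primeFactors.Nonempty := by
      rw [← Finset.card_pos]; omega
    have hqm : q m ∈ m.primeFactors := by
      obtain ⟨p, hp, h⟩ := Finset.exists_mem_eq_sup _ hne (id : ℕ → ℕ)
      simp only [hq, h]
      exact hp
    have hqle : ∀ p ∈ m.primeFactors, p ≤ q m := fun p hp => Finset.le_sup (f := id) hp
    have hqp := Nat.prime_of_mem_primeFactors hqm
    have hv : 0 < m.factorization (q m) :=
      hqp.factorization_pos_of_dvd hm0 (Nat.dvd_of_mem_primeFactors hqm)
    have hmul := Nat.ordProj_mul_ordCompl_eq_self m (q m)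
    have hd0 : 0 < ordCompl[q m] m := Nat.ordCompl_pos _ hm0
    have hpf : (ordCompl[q m] m).primeFactors = m.primeFactors.erase (q m) := by
      rw [← Nat.support_factorization, Nat.factorization_ordCompl, Finsupp.support_erase,
        Nat.support_factorization]
    have hqu : q m ≤ ordProj[q m] m := Nat.le_self_pow hv.ne' _
    have hpow : IsPrimePow (ordProj[q m] m) := hqp.isPrimePow.pow hv.ne'
    generalize ordCompl[q m] m = d at *
    generalize ordProj[q m] m = u at *
    have hmN : u * d ≤ N := by omega
    have hq2 := hqp.two_le
    have hle : ∀ p, p ≤ q m → p * d ≤ N := fun p hp =>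
      (Nat.mul_le_mul_right d (hp.trans hqu)).trans hmN
    have h6 : 6 * d * u = 6 * m := by rw [← hmul]; ring
    simp only [mem_coe, mem_sigma, mem_filter, mem_Icc]
    refine ⟨⟨⟨hd0, ?_⟩, ?_, hle 2 hq2, ?_⟩, ⟨by omega, ?_⟩, hpow, ?_, ?_⟩
    · have := hle 2 hq2
      omega
    · rw [hpf, card_erase_of_mem hqm, hc]
    · intro p hp
      rw [hpf] at hp
      exact hle p (hqle p (mem_of_mem_erase hp))
    · rwa [Nat.le_div_iff_mul_le hd0]
    · rwa [h6]
    · rwa [h6]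
  · intro a ha b hb hab
    simp only [coe_filter, Set.mem_ofPred_eq, mem_Ioc] at ha hb
    have h1 := six_dvd_of_prime_sub_one_of_prime_add_one ha.1.1 ha.2.1 ha.2.2.1
    have h2 := six_dvd_of_prime_sub_one_of_prime_add_one hb.1.1 hb.2.1 hb.2.2.1
    have hab1 := congrArg Sigma.fst hab
    have hab2 : ordProj[q (a / 6)] (a / 6) = ordProj[q (b / 6)] (b / 6) :=
      congrArg (fun s : (_ : ℕ) × ℕ => s.2) hab
    have : a / 6 = b / 6 := by
      have h3 := congrArg₂ (· * ·) hab2 hab1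
      simpa only [Nat.ordProj_mul_ordCompl_eq_self] using h3
    omega

theorem prod_one_add_inv_primeFactors_six_mul_le (d : ℕ) (hd : d ≠ 0) :
    ∏ p ∈ (6 * d).primeFactors, (1 + (p : ℝ)⁻¹)
      ≤ 2 * ∏ p ∈ d.primeFactors, (1 + (p : ℝ)⁻¹) := by
  have h6 : Nat.primeFactors 6 = {2, 3} := by
    rw [show 6 = 2 * 3 by norm_num, Nat.primeFactors_mul (by norm_num) (by norm_num),
      Nat.prime_two.primeFactors, Nat.prime_three.primeFactors]
    rfl
  rw [Nat.primeFactors_mul (by norm_num) hd, h6]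
  have h1 := Finset.prod_union_inter (s₁ := {2, 3}) (s₂ := d.primeFactors)
    (f := fun p : ℕ => 1 + (p : ℝ)⁻¹)
  have h2 : ∏ p ∈ ({2, 3} : Finset ℕ), (1 + (p : ℝ)⁻¹) = 2 := by
    rw [Finset.prod_pair (by norm_num)]
    norm_num
  rw [h2] at h1
  rw [← h1]
  refine le_mul_of_one_le_right (Finset.prod_nonneg fun p _ => by positivity) ?_
  refine Finset.one_le_prod fun p _ => ?_
  have : (0 : ℝ) ≤ (p : ℝ)⁻¹ := by positivity
  linarith

theorem exists_factorial_mul_sum_smooth_le :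
    ∃ C : ℝ, ∀ (N z r : ℕ) (δ : ℝ), 2 ≤ z → 0 ≤ δ → δ ≤ 1 / 4 → δ * Real.log z ≤ 1 →
      0 ≤ Real.log (Real.log z) + C ∧
      (r.factorial : ℝ) * ∑ d ∈ ((Icc 1 N).filter fun d => ∀ p ∈ d.primeFactors, p ≤ z) with
          d.primeFactors.card = r,
          (∏ p ∈ d.primeFactors, (1 + (p : ℝ)⁻¹)) ^ 2 * (d : ℝ) ^ (δ - 1)
        ≤ (Real.log (Real.log z) + C) ^ r := by
  obtain ⟨C, hC⟩ := exists_sum_rankinWeight_le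
  refine ⟨C, fun N z r δ hz hδ0 hδ hδz => ?_⟩
  have h := hC z N δ hz hδ0 hδ hδz
  have hS : 0 ≤ ∑ p ∈ Ioc 0 z with p.Prime, ∑ a ∈ Icc 1 N, rankinWeight δ p a :=
    Finset.sum_nonneg fun p _ => Finset.sum_nonneg fun a _ => rankinWeight_nonneg δ p a
  refine ⟨hS.trans h, ?_⟩
  refine le_trans ?_ (pow_le_pow_left₀ hS h r)
  rw [Finset.sum_congr rfl fun d hd => (prod_rankinWeight δ (d := d) ?_).symm]
  · refine factorial_mul_sum_primeFactors_card_eq_le (rankinWeight_nonneg δ) ?_ ?_ ?_ ?_ r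
    · intro d hd
      rw [mem_filter, mem_Icc] at hd
      omega
    · intro d hd p hp
      rw [mem_filter] at hd
      have hpp := Nat.prime_of_mem_primeFactors hp
      exact mem_filter.2 ⟨mem_Ioc.2 ⟨hpp.pos, hd.2 p hp⟩, hpp⟩
    · intro d hd p
      rw [mem_filter, mem_Icc] at hd
      exact (Nat.factorization_lt p (by omega)).le.trans hd.1.2
    · intro d hd p hp
      rw [mem_filter, mem_Icc] at hd ⊢
      have hdvd := Nat.ordCompl_dvd d p
      refine ⟨⟨Nat.ordCompl_pos p (by omega), (Nat.le_of_dvd (by omega) hdvd).trans hd.1.2⟩,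
        fun s hs => hd.2 s (Nat.primeFactors_mono hdvd (by omega) hs)⟩
  · rw [mem_filter, mem_filter, mem_Icc] at hd
    omega

theorem exists_scale_of_two_mul_le {x : ℝ} (hx : 2 ≤ x) {d : ℕ} (hd : 1 ≤ d)
    (h2 : 2 * (d : ℝ) ≤ x) :
    ∃ i ∈ Icc 1 ⌊Real.log x / Real.log 2⌋₊,
      (∀ p : ℕ, (p : ℝ) * d ≤ x → p ≤ ⌊x ^ (i : ℝ)⁻¹⌋₊) ∧
      1 / Real.log (x / d) ^ 3 ≤ ((i : ℝ) + 1) ^ 3 / Real.log x ^ 3 ∧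
      1 ≤ Real.exp ((1 - i) / 8) * (d : ℝ) ^ (i / (8 * Real.log x)) := by
  have hx0 : 0 < x := by linarith
  have hd1 : (1 : ℝ) ≤ d := by exact_mod_cast hd
  have hd0 : (0 : ℝ) < d := by linarith
  have hl2 : 0 < Real.log 2 := Real.log_pos (by norm_num)
  have hL : 0 < Real.log x := Real.log_pos (by linarith)
  have hld : 0 ≤ Real.log d := Real.log_nonneg hd1
  have hy : 2 ≤ x / d := by rwa [le_div_iff₀ hd0]
  have hl : Real.log (x / d) = Real.log x - Real.log d := Real.log_div hx0.ne' hd0.ne'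
  have hl2l : Real.log 2 ≤ Real.log (x / d) := Real.log_le_log (by norm_num) hy
  have hexp : x / d = Real.exp (Real.log (x / d)) := (Real.exp_log (by positivity)).symm
  set L := Real.log x with hLdef
  set l := Real.log (x / d) with hldef
  have hl0 : 0 < l := by linarith
  have hi1 : 1 ≤ ⌊L / l⌋₊ := by
    rw [Nat.one_le_floor_iff, le_div_iff₀ hl0]
    linarith
  have hile : (⌊L / l⌋₊ : ℝ) ≤ L / l := Nat.floor_le (by positivity)
  have hilt : L / l < ⌊L / l⌋₊ + 1 := Nat.lt_floor_add_one _
  have hiI : ⌊L / l⌋₊ ≤ ⌊L / Real.log 2⌋₊ := Nat.floor_le_floor (by gcongr)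
  generalize ⌊L / l⌋₊ = i at *
  have hi0 : (0 : ℝ) < i := by exact_mod_cast hi1
  rw [le_div_iff₀ hl0] at hile
  rw [div_lt_iff₀ hl0] at hilt
  refine ⟨i, mem_Icc.2 ⟨hi1, hiI⟩, fun p hp => Nat.le_floor ?_, ?_, ?_⟩
  · rw [← le_div_iff₀ hd0] at hp
    refine hp.trans ?_
    rw [hexp, Real.rpow_def_of_pos hx0]
    refine Real.exp_le_exp.2 ?_
    rw [← div_eq_mul_inv, le_div_iff₀ hi0]
    linarith
  · rw [div_le_div_iff₀ (by positivity) (by positivity), one_mul, ← mul_pow]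
    exact pow_le_pow_left₀ hL.le hilt.le 3
  · rw [Real.rpow_def_of_pos hd0, ← Real.exp_add]
    refine Real.one_le_exp ?_
    have h1 : Real.log d * (i / (8 * L)) = (L - l) * i / (8 * L) := by rw [hl]; ring
    have h2 : (1 - (i : ℝ)) / 8 = (1 - i) * L / (8 * L) := by field_simp
    rw [h1, h2, ← add_div]
    refine div_nonneg ?_ (by positivity)
    nlinarith

theorem exists_sum_scale_le :
    ∃ S : ℝ, ∀ I : ℕ, ∑ i ∈ Icc 1 I, ((i : ℝ) + 1) ^ 3 * Real.exp ((1 - i) / 8) ≤ S := by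
  have hsum : Summable fun n : ℕ => (n : ℝ) ^ 3 * Real.exp (-n * (1 / 8)) := by
    simpa [mul_comm] using Real.summable_pow_mul_exp_neg_nat_mul 3 (r := 1 / 8) (by norm_num)
  refine ⟨Real.exp (1 / 4) * ∑' n : ℕ, (n : ℝ) ^ 3 * Real.exp (-n * (1 / 8)), fun I => ?_⟩
  have h : ∑ i ∈ Icc 1 I, ((i : ℝ) + 1) ^ 3 * Real.exp ((1 - i) / 8)
      = Real.exp (1 / 4) *
        ∑ i ∈ Icc 1 I, ((i + 1 : ℕ) : ℝ) ^ 3 * Real.exp (-(i + 1 : ℕ) * (1 / 8)) := by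
    rw [Finset.mul_sum]
    refine Finset.sum_congr rfl fun i _ => ?_
    rw [mul_left_comm, ← Real.exp_add]
    push_cast
    ring_nf
  rw [h]
  refine mul_le_mul_of_nonneg_left ?_ (Real.exp_pos _).le
  rw [← Finset.sum_image (f := fun n : ℕ => (n : ℝ) ^ 3 * Real.exp (-n * (1 / 8)))
    (g := fun i : ℕ => i + 1) (fun a _ b _ h => by simpa using h)]
  exact hsum.sum_le_tsum _ fun n _ => by positivity

theorem exists_sum_div_mul_log_pow_le :
    ∃ C₁ C₂ : ℝ, 0 ≤ C₁ ∧ ∀ (x : ℝ) (r : ℕ), 2 ≤ x →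
      ∑ d ∈ (Icc 1 ⌊x⌋₊).filter fun d => d.primeFactors.card = r ∧ 2 * d ≤ ⌊x⌋₊ ∧
          ∀ p ∈ d.primeFactors, p * d ≤ ⌊x⌋₊,
        (∏ p ∈ d.primeFactors, (1 + (p : ℝ)⁻¹)) ^ 2 * (d : ℝ)⁻¹ * (1 / Real.log (x / d) ^ 3)
      ≤ C₁ * ((Real.log (Real.log x) + C₂) ^ r / (r.factorial * Real.log x ^ 3)) := by
  obtain ⟨C, hC⟩ := exists_factorial_mul_sum_smooth_le
  obtain ⟨S, hS⟩ := exists_sum_scale_le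
  have hS0 : 0 ≤ S := by simpa using hS 0
  refine ⟨S, C, hS0, fun x r hx => ?_⟩
  have hx0 : 0 < x := by linarith
  have hl2 : 0 < Real.log 2 := Real.log_pos (by norm_num)
  have hL : 0 < Real.log x := Real.log_pos (by linarith)
  set L := Real.log x with hLdef
  set I := ⌊L / Real.log 2⌋₊ with hI
  set z : ℕ → ℕ := fun i => ⌊x ^ (i : ℝ)⁻¹⌋₊ with hz
  set c : ℕ → ℝ := fun i => ((i : ℝ) + 1) ^ 3 / L ^ 3 * Real.exp ((1 - i) / 8) with hc
  have hc0 : ∀ i, 0 ≤ c i := fun i => by positivity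
  set F : ℕ → ℕ → ℝ := fun i d =>
    (∏ p ∈ d.primeFactors, (1 + (p : ℝ)⁻¹)) ^ 2 * (d : ℝ) ^ (i / (8 * L) - 1) with hF
  have hF0 : ∀ i d, 0 ≤ F i d := fun i d => by positivity
  have h1 : ∀ d ∈ (Icc 1 ⌊x⌋₊).filter fun d => d.primeFactors.card = r ∧ 2 * d ≤ ⌊x⌋₊ ∧
          ∀ p ∈ d.primeFactors, p * d ≤ ⌊x⌋₊,
      (∏ p ∈ d.primeFactors, (1 + (p : ℝ)⁻¹)) ^ 2 * (d : ℝ)⁻¹ * (1 / Real.log (x / d) ^ 3)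
        ≤ ∑ i ∈ Icc 1 I, if ∀ p ∈ d.primeFactors, p ≤ z i then c i * F i d else 0 := by
    intro d hd
    rw [mem_filter, mem_Icc] at hd
    obtain ⟨⟨hd1, -⟩, -, hd2, hdp⟩ := hd
    have hd0 : (0 : ℝ) < d := by exact_mod_cast hd1
    have hfl : ∀ p : ℕ, p * d ≤ ⌊x⌋₊ → (p : ℝ) * d ≤ x := fun p hp => by
      have := (Nat.le_floor_iff hx0.le).1 hp
      exact_mod_cast this
    obtain ⟨i, hi, hip, hil, hie⟩ := exists_scale_of_two_mul_le hx hd1 (hfl 2 hd2)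
    refine le_trans ?_ (Finset.single_le_sum (fun j _ => ?_) hi)
    · rw [if_pos fun p hp => hip p (hfl p (hdp p hp))]
      calc _ ≤ (∏ p ∈ d.primeFactors, (1 + (p : ℝ)⁻¹)) ^ 2 * (d : ℝ)⁻¹
              * (((i : ℝ) + 1) ^ 3 / L ^ 3) := by gcongr
        _ = (∏ p ∈ d.primeFactors, (1 + (p : ℝ)⁻¹)) ^ 2 * (d : ℝ)⁻¹
              * (((i : ℝ) + 1) ^ 3 / L ^ 3) * 1 := (mul_one _).symm
        _ ≤ (∏ p ∈ d.primeFactors, (1 + (p : ℝ)⁻¹)) ^ 2 * (d : ℝ)⁻¹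
              * (((i : ℝ) + 1) ^ 3 / L ^ 3)
              * (Real.exp ((1 - i) / 8) * (d : ℝ) ^ (i / (8 * L))) := by gcongr
        _ = _ := by
            simp only [hc, hF]
            rw [Real.rpow_sub_one hd0.ne']
            ring
    · split_ifs
      · exact mul_nonneg (hc0 _) (hF0 _ _)
      · exact le_rfl
  have h2 : ∀ i ∈ Icc 1 I, ∑ d ∈ ((Icc 1 ⌊x⌋₊).filter fun d =>
        ∀ p ∈ d.primeFactors, p ≤ z i) with d.primeFactors.card = r, F i d
      ≤ (Real.log L + C) ^ r / r.factorial := by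
    intro i hi
    rw [mem_Icc] at hi
    have hi1 : (1 : ℝ) ≤ i := by exact_mod_cast hi.1
    have hi0 : (0 : ℝ) < i := by linarith
    have hiL : (i : ℝ) * Real.log 2 ≤ L := by
      rw [← le_div_iff₀ hl2]
      exact (Nat.le_floor_iff (by positivity)).1 hi.2
    have hz2 : 2 ≤ z i := by
      refine Nat.le_floor ?_
      rw [Real.rpow_def_of_pos hx0, ← div_eq_mul_inv]
      push_cast
      rw [← Real.log_le_iff_le_exp (by norm_num), le_div_iff₀ hi0]
      linarith
    have hz2' : (2 : ℝ) ≤ z i := by exact_mod_cast hz2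
    have hlz0 : 0 < Real.log (z i) := Real.log_pos (by linarith)
    have hlz : Real.log (z i) ≤ L / i := by
      calc Real.log (z i) ≤ Real.log (x ^ (i : ℝ)⁻¹) :=
            Real.log_le_log (by linarith) (Nat.floor_le (by positivity))
        _ = L / i := by rw [Real.log_rpow hx0]; ring
    have hlzL : Real.log (z i) ≤ L := hlz.trans (div_le_self hL.le hi1)
    have hδ : (i : ℝ) / (8 * L) ≤ 1 / 4 := by
      rw [div_le_div_iff₀ (by positivity) (by norm_num)]
      have := Real.log_two_gt_d9
      nlinarith
    have hδz : (i : ℝ) / (8 * L) * Real.log (z i) ≤ 1 := by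
      calc _ ≤ (i : ℝ) / (8 * L) * (L / i) := by gcongr
        _ = 1 / 8 := by field_simp
        _ ≤ 1 := by norm_num
    obtain ⟨h3, h4⟩ := hC ⌊x⌋₊ (z i) r _ hz2 (by positivity) hδ hδz
    rw [le_div_iff₀ (by positivity), mul_comm]
    refine h4.trans (pow_le_pow_left₀ h3 ?_ r)
    have := Real.log_le_log hlz0 hlzL
    linarith
  have hI1 : 1 ≤ I := by
    rw [hI, Nat.one_le_floor_iff, le_div_iff₀ hl2, one_mul]
    exact Real.log_le_log (by norm_num) hx
  have hpow : 0 ≤ (Real.log L + C) ^ r / r.factorial :=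
    (Finset.sum_nonneg fun d _ => hF0 1 d).trans (h2 1 (mem_Icc.2 ⟨le_rfl, hI1⟩))
  calc _ ≤ ∑ d ∈ (Icc 1 ⌊x⌋₊).filter fun d => d.primeFactors.card = r ∧ 2 * d ≤ ⌊x⌋₊ ∧
          ∀ p ∈ d.primeFactors, p * d ≤ ⌊x⌋₊,
        ∑ i ∈ Icc 1 I, (if ∀ p ∈ d.primeFactors, p ≤ z i then c i * F i d else 0) :=
        Finset.sum_le_sum h1
    _ ≤ ∑ d ∈ (Icc 1 ⌊x⌋₊).filter fun d => d.primeFactors.card = r,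
        ∑ i ∈ Icc 1 I, (if ∀ p ∈ d.primeFactors, p ≤ z i then c i * F i d else 0) := by
        refine Finset.sum_le_sum_of_subset_of_nonneg ?_ fun d _ _ => ?_
        · exact Finset.monotone_filter_right _ fun d _ hd => hd.1
        · refine Finset.sum_nonneg fun i _ => ?_
          split_ifs
          · exact mul_nonneg (hc0 _) (hF0 _ _)
          · exact le_rfl
    _ = ∑ i ∈ Icc 1 I, c i * ∑ d ∈ ((Icc 1 ⌊x⌋₊).filter fun d =>
        ∀ p ∈ d.primeFactors, p ≤ z i) with d.primeFactors.card = r, F i d := by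
        rw [Finset.sum_comm]
        refine Finset.sum_congr rfl fun i _ => ?_
        rw [Finset.filter_comm, Finset.sum_filter (s := (Icc 1 ⌊x⌋₊).filter _), Finset.mul_sum]
        refine Finset.sum_congr rfl fun d _ => ?_
        rw [mul_ite, mul_zero]
    _ ≤ ∑ i ∈ Icc 1 I, c i * ((Real.log L + C) ^ r / r.factorial) :=
        Finset.sum_le_sum fun i hi => mul_le_mul_of_nonneg_left (h2 i hi) (hc0 i)
    _ = (∑ i ∈ Icc 1 I, ((i : ℝ) + 1) ^ 3 * Real.exp ((1 - i) / 8))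
          * ((Real.log L + C) ^ r / r.factorial / L ^ 3) := by
        rw [Finset.sum_mul]
        refine Finset.sum_congr rfl fun i _ => ?_
        simp only [hc]
        ring
    _ ≤ S * ((Real.log L + C) ^ r / r.factorial / L ^ 3) := by
        gcongr
        exact hS I
    _ = _ := by rw [div_div]

/-- Corollary 4: the number of `4 < n ≤ x` with `n-1` and `n+1` both prime and
`ω(n/6) = k` is `≪ x (log log x + O(1))^(k-1) / ((k-1)! (log x)^3)`, uniformly in `k`. -/
theorem twin_primes_mean_HardyRamanujan :
    ∃ C₁ C₂ : ℝ, ∀ (x : ℝ) (k : ℕ),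
      2 ≤ x → 1 ≤ k →
      (((Finset.Ioc 4 ⌊x⌋₊).filter
          (fun n => (n - 1).Prime ∧ (n + 1).Prime ∧ (n / 6).primeFactors.card = k)).card : ℝ)
        ≤ C₁ * x * (Real.log (Real.log x) + C₂) ^ (k - 1) /
            ((Nat.factorial (k - 1) : ℝ) * (Real.log x) ^ 3) := by
  obtain ⟨A, hA0, hA⟩ := exists_card_primePow_twin_le
  obtain ⟨C₁, C₂, -, hC⟩ := exists_sum_div_mul_log_pow_le
  refine ⟨4 * A * C₁, C₂, fun x k hx hk => ?_⟩
  have hx0 : 0 < x := by linarith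
  have hterm : ∀ d ∈ (Icc 1 ⌊x⌋₊).filter fun d => d.primeFactors.card = k - 1 ∧
        2 * d ≤ ⌊x⌋₊ ∧ ∀ p ∈ d.primeFactors, p * d ≤ ⌊x⌋₊,
      (((Icc 1 (⌊x⌋₊ / d)).filter fun u =>
          IsPrimePow u ∧ (6 * d * u - 1).Prime ∧ (6 * d * u + 1).Prime).card : ℝ)
        ≤ 4 * A * x * ((∏ p ∈ d.primeFactors, (1 + (p : ℝ)⁻¹)) ^ 2 * (d : ℝ)⁻¹
          * (1 / Real.log (x / d) ^ 3)) := by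
    intro d hd
    rw [mem_filter, mem_Icc] at hd
    obtain ⟨⟨hd1, -⟩, -, hd2, -⟩ := hd
    have hd0 : (0 : ℝ) < d := by exact_mod_cast hd1
    have hY : 2 ≤ x / d := by
      rw [le_div_iff₀ hd0]
      have := (Nat.le_floor_iff hx0.le).1 hd2
      exact_mod_cast this
    have hlog : 0 < Real.log (x / d) := Real.log_pos (by linarith)
    have h := hA (x / d) (6 * d) hY (dvd_mul_right 6 d) (by omega)
    rw [Nat.floor_div_natCast] at h
    have h6 := prod_one_add_inv_primeFactors_six_mul_le d (by omega)
    have h60 : 0 ≤ ∏ p ∈ (6 * d).primeFactors, (1 + (p : ℝ)⁻¹) :=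
      Finset.prod_nonneg fun p _ => by positivity
    calc _ ≤ A * (∏ p ∈ (6 * d).primeFactors, (1 + (p : ℝ)⁻¹)) ^ 2
            * (x / d / Real.log (x / d) ^ 3) := h
      _ ≤ A * (2 * ∏ p ∈ d.primeFactors, (1 + (p : ℝ)⁻¹)) ^ 2
            * (x / d / Real.log (x / d) ^ 3) := by gcongr
      _ = _ := by ring
  calc _ ≤ ∑ d ∈ (Icc 1 ⌊x⌋₊).filter fun d => d.primeFactors.card = k - 1 ∧
          2 * d ≤ ⌊x⌋₊ ∧ ∀ p ∈ d.primeFactors, p * d ≤ ⌊x⌋₊,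
        (((Icc 1 (⌊x⌋₊ / d)).filter fun u =>
          IsPrimePow u ∧ (6 * d * u - 1).Prime ∧ (6 * d * u + 1).Prime).card : ℝ) := by
        exact_mod_cast card_twin_filter_le_sum ⌊x⌋₊ hk
    _ ≤ _ := Finset.sum_le_sum hterm
    _ ≤ 4 * A * x * (C₁ * ((Real.log (Real.log x) + C₂) ^ (k - 1)
          / ((k - 1).factorial * Real.log x ^ 3))) := by
        rw [← Finset.mul_sum]
        exact mul_le_mul_of_nonneg_left (hC x (k - 1) hx) (by positivity)
    _ = _ := by ring
end

section
/- (Hardy–Ramanujan inequality, recovered from the main theorem.) There exist absolute constants C₁ and C₂ such that for all real x ≥ 2 and all positive integers k, #{ n ≤ x : ω(n) = k } ≤ C₁ · (x/log x) · (log log x + C₂)^{k−1} / (k−1)!. -/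
open Finset

/-- The sum of the logarithms of the prime factors of `m` is at most `log m`. -/
theorem sum_log_primeFactors_le {m : ℕ} (hm : m ≠ 0) :
    ∑ p ∈ m.primeFactors, Real.log p ≤ Real.log m := by
  rw [← Real.log_prod fun p hp => by exact_mod_cast (Nat.prime_of_mem_primeFactors hp).ne_zero,
    ← Nat.cast_prod]
  refine Real.log_le_log ?_ ?_
  · exact_mod_cast Finset.prod_pos fun p hp => (Nat.prime_of_mem_primeFactors hp).pos
  · exact_mod_cast Nat.le_of_dvd (Nat.pos_of_ne_zero hm) (Nat.prod_primeFactors_dvd m)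

theorem sum_div_mul_log_le (n : ℕ) :
    ∑ p ∈ n.primesLE, ((n / p : ℕ) : ℝ) * Real.log p ≤ n * Real.log n := by
  calc ∑ p ∈ n.primesLE, ((n / p : ℕ) : ℝ) * Real.log p
      = ∑ p ∈ n.primesLE, ∑ m ∈ Ioc 0 n, if p ∣ m then Real.log p else 0 := by
        refine sum_congr rfl fun p _ => ?_
        rw [← sum_filter, sum_const, Nat.Ioc_filter_dvd_card_eq_div, nsmul_eq_mul]
    _ = ∑ m ∈ Ioc 0 n, ∑ p ∈ n.primesLE, if p ∣ m then Real.log p else 0 := sum_comm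
    _ ≤ ∑ m ∈ Ioc 0 n, Real.log n := by
        refine sum_le_sum fun m hm => ?_
        obtain ⟨hm0, hmn⟩ := mem_Ioc.mp hm
        rw [← sum_filter]
        have : n.primesLE.filter (· ∣ m) = m.primeFactors := by
          ext p
          simp only [mem_filter, Nat.mem_primesLE, Nat.mem_primeFactors]
          exact ⟨fun h => ⟨h.1.2, h.2, hm0.ne'⟩,
            fun h => ⟨⟨(Nat.le_of_dvd hm0 h.2.1).trans hmn, h.1⟩, h.2.1⟩⟩
        rw [this]
        exact (sum_log_primeFactors_le hm0.ne').trans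
          (Real.log_le_log (by exact_mod_cast hm0) (by exact_mod_cast hmn))
    _ = n * Real.log n := by simp

/-- The upper bound in the first theorem of Mertens. -/
theorem sum_log_div_prime_le_s6 {n : ℕ} (hn : n ≠ 0) :
    ∑ p ∈ n.primesLE, Real.log p / p ≤ Real.log n + Real.log 4 := by
  have hn' : (0 : ℝ) < n := by positivity
  refine le_of_mul_le_mul_left ?_ hn'
  calc (n : ℝ) * ∑ p ∈ n.primesLE, Real.log p / p
      ≤ ∑ p ∈ n.primesLE, (((n / p : ℕ) : ℝ) * Real.log p + Real.log p) := by
        rw [mul_sum]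
        refine sum_le_sum fun p _ => ?_
        have h := (Nat.lt_floor_add_one ((n : ℝ) / p)).le
        rw [Nat.floor_div_natCast, Nat.floor_natCast] at h
        calc (n : ℝ) * (Real.log p / p) = (n : ℝ) / p * Real.log p := by ring
          _ ≤ (((n / p : ℕ) : ℝ) + 1) * Real.log p := by gcongr
          _ = _ := by ring
    _ ≤ n * Real.log n + Real.log 4 * n := by
        rw [sum_add_distrib, ← Chebyshev.theta_eq_sum_primesLE_log]
        exact add_le_add (sum_div_mul_log_le n) (Chebyshev.theta_le_log4_mul_x hn'.le)
    _ = n * (Real.log n + Real.log 4) := by ring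

/-- Partial summation, in the form of an induction, deduces the second theorem of Mertens from the
first. -/
theorem sum_inv_prime_le_sub {n : ℕ} (hn : 2 ≤ n) :
    ∑ p ∈ n.primesLE, (p : ℝ)⁻¹ ≤ Real.log (Real.log n) + (3 - Real.log (Real.log 2)) -
      (Real.log n + Real.log 4 - ∑ p ∈ n.primesLE, Real.log p / p) / Real.log n := by
  induction n, hn using Nat.le_induction with
  | base =>
    have h2 : Nat.primesLE 2 = {2} := by decide
    have h4 : Real.log 4 = 2 * Real.log 2 := by
      rw [show (4 : ℝ) = 2 ^ 2 by norm_num, Real.log_pow]; norm_num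
    have hl : Real.log 2 ≠ 0 := (Real.log_pos one_lt_two).ne'
    simp only [h2, sum_singleton, Nat.cast_ofNat, h4]
    field_simp
    norm_num
  | succ n hn ih =>
    have hnR : (1 : ℝ) < n := by exact_mod_cast hn
    set S := ∑ p ∈ n.primesLE, Real.log p / p
    set l := Real.log n
    set l' := Real.log (n + 1 : ℕ) with hl'
    have hl : 0 < l := Real.log_pos hnR
    have hll : l ≤ l' := Real.log_le_log (by linarith) (by push_cast; linarith)
    have hl'0 : 0 < l' := hl.trans_le hll
    have hD : 0 ≤ l + Real.log 4 - S := by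
      linarith [sum_log_div_prime_le_s6 (n := n) (by lia)]
    have hinv : (l + Real.log 4 - S) / l' ≤ (l + Real.log 4 - S) / l :=
      div_le_div_of_nonneg_left hD hl hll
    have hconc : (l' - l) / l' ≤ Real.log l' - Real.log l := by
      have := Real.one_sub_inv_le_log_of_pos (div_pos hl'0 hl)
      rw [Real.log_div hl'0.ne' hl.ne', inv_div] at this
      rwa [sub_div, div_self hl'0.ne']
    rw [Nat.primesLE_succ]
    split_ifs with hp
    · rw [sum_insert (Nat.notMem_primesLE n), sum_insert (Nat.notMem_primesLE n), ← hl']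
      have : (l' + Real.log 4 - (l' / (n + 1 : ℕ) + S)) / l'
          = (l + Real.log 4 - S) / l' + (l' - l) / l' - ((n + 1 : ℕ) : ℝ)⁻¹ := by
        field_simp; ring
      linarith
    · have : (l' + Real.log 4 - S) / l' = (l + Real.log 4 - S) / l' + (l' - l) / l' := by
        field_simp; ring
      linarith

/-- The upper bound in the second theorem of Mertens. -/
theorem sum_inv_prime_le {n : ℕ} (hn : 2 ≤ n) :
    ∑ p ∈ n.primesLE, (p : ℝ)⁻¹ ≤
      Real.log (Real.log n) + (3 - Real.log (Real.log 2)) := by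
  have : 0 ≤ (Real.log n + Real.log 4 - ∑ p ∈ n.primesLE, Real.log p / p) / Real.log n :=
    div_nonneg (by linarith [sum_log_div_prime_le_s6 (n := n) (by lia)]) (Real.log_natCast_nonneg n)
  linarith [sum_inv_prime_le_sub hn]

/-- The integers `1 ≤ n ≤ x` with exactly `k` distinct prime factors. -/
noncomputable def withOmega (x : ℝ) (k : ℕ) : Finset ℕ :=
  (Icc 1 ⌊x⌋₊).filter fun n => n.primeFactors.card = k

/-- The exponents `a ≥ 1` with `p ^ (a + 1) ≤ x`. -/
noncomputable def smallExponents (x : ℝ) (p : ℕ) : Finset ℕ :=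
  (Icc 1 ⌊x⌋₊).filter fun a => p ^ (a + 1) ≤ ⌊x⌋₊

theorem withOmega_one_subset (x : ℝ) :
    withOmega x 1 ⊆ ⌊x⌋₊.primesLE ∪
      (Icc 1 ⌊x⌋₊.sqrt ×ˢ Icc 1 (Nat.log 2 ⌊x⌋₊)).image fun q => q.1 ^ q.2 := by
  intro n hn
  obtain ⟨hn, hω⟩ := mem_filter.mp hn
  obtain ⟨hn1, hnx⟩ := mem_Icc.mp hn
  obtain ⟨p, a, hp, ha, rfl⟩ :=
    (isPrimePow_nat_iff n).mp (isPrimePow_iff_card_primeFactors_eq_one.mpr hω)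
  obtain rfl | ha2 : a = 1 ∨ 2 ≤ a := by lia
  · exact mem_union_left _ (Nat.mem_primesLE.mpr ⟨by simpa using hnx, by simpa using hp⟩)
  · refine mem_union_right _ (mem_image.mpr ⟨(p, a), ?_, rfl⟩)
    simp only [mem_product, mem_Icc]
    refine ⟨⟨hp.one_le, Nat.le_sqrt'.mpr ((Nat.pow_le_pow_right hp.pos ha2).trans hnx)⟩, ha, ?_⟩
    exact Nat.le_log_of_pow_le one_lt_two ((Nat.pow_le_pow_left hp.two_le a).trans hnx)

/-- The Chebyshev bound for the number of prime powers up to `x`. -/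
theorem card_withOmega_one_le {x : ℝ} (hx : 2 ≤ x) :
    ((withOmega x 1).card : ℝ) ≤
      (2 * Real.log 4 + 2 + 16 / Real.log 2) * (x / Real.log x) := by
  have hx0 : 0 < x := by linarith
  have hl : 0 < Real.log x := Real.log_pos (by linarith)
  have hl2 : 0 < Real.log 2 := Real.log_pos one_lt_two
  have hfl : (⌊x⌋₊ : ℝ) ≤ x := Nat.floor_le hx0.le
  have hcard : ((withOmega x 1).card : ℝ) ≤
      (⌊x⌋₊.primeCounting : ℝ) + (⌊x⌋₊.sqrt : ℝ) * (Nat.log 2 ⌊x⌋₊ : ℝ) := by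
    have h := (card_le_card (withOmega_one_subset x)).trans
      ((card_union_le _ _).trans (Nat.add_le_add_left card_image_le _))
    rw [card_product, Nat.card_Icc, Nat.card_Icc, Nat.primesLE_card_eq_primeCounting] at h
    exact_mod_cast h
  have hsqrt : (⌊x⌋₊.sqrt : ℝ) ≤ √x := Real.nat_sqrt_le_real_sqrt.trans (Real.sqrt_le_sqrt hfl)
  have hlog : (Nat.log 2 ⌊x⌋₊ : ℝ) ≤ Real.log x / Real.log 2 := by
    rw [le_div_iff₀ hl2, ← Real.log_pow]
    refine Real.log_le_log (by positivity) (le_trans ?_ hfl)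
    exact_mod_cast Nat.pow_log_le_self 2 (Nat.floor_pos.mpr (by linarith)).ne'
  have hπ := Chebyshev.pi_le_log4_mul_div (x := x) (by linarith)
  have hlog_sq : Real.log x ^ 2 ≤ 16 * √x := by
    have h := Real.log_le_rpow_div hx0.le (ε := 1 / 4) (by norm_num)
    calc Real.log x ^ 2 ≤ (x ^ (1 / 4 : ℝ) / (1 / 4)) ^ 2 := by gcongr
      _ = 16 * (x ^ (1 / 4 : ℝ)) ^ 2 := by ring
      _ = 16 * √x := by
        rw [← Real.rpow_natCast, ← Real.rpow_mul hx0.le, Real.sqrt_eq_rpow]; norm_num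
  have hlog_le : Real.log x ≤ 2 * √x := by
    have h := Real.log_le_rpow_div hx0.le (ε := 1 / 2) (by norm_num)
    rw [← Real.sqrt_eq_rpow] at h
    linarith
  have hss : √x * √x = x := Real.mul_self_sqrt hx0.le
  have hs : 0 ≤ √x := Real.sqrt_nonneg x
  rw [Real.log_sqrt hx0.le] at hπ
  have h1 : √x ≤ 2 * (x / Real.log x) := by
    rw [← mul_div_assoc, le_div_iff₀ hl]
    nlinarith
  have h2 : √x * (Real.log x / Real.log 2) ≤ 16 / Real.log 2 * (x / Real.log x) := by
    rw [div_mul_div_comm, ← mul_div_assoc, div_le_div_iff₀ hl2 (by positivity)]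
    have : √x * Real.log x ^ 2 ≤ 16 * x := by nlinarith
    nlinarith
  have h3 : (⌊x⌋₊.sqrt : ℝ) * (Nat.log 2 ⌊x⌋₊ : ℝ) ≤ √x * (Real.log x / Real.log 2) := by
    gcongr
  have h4 : Real.log 4 * x / (Real.log x / 2) = 2 * Real.log 4 * (x / Real.log x) := by
    field_simp
  linarith

/-- Removing the full power of the prime `p` from `n` lowers the number of prime factors by one. -/
theorem card_filter_withOmega_le (x : ℝ) (k a : ℕ) {p : ℕ} (hp : p.Prime) (ha : a ≠ 0) :
    ((withOmega x (k + 1)).filter fun n => n.factorization p = a).card ≤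
      (withOmega (x / (p : ℝ) ^ a) k).card := by
  have hpa : 0 < p ^ a := pow_pos hp.pos a
  have hdvd : ∀ {n : ℕ}, n.factorization p = a → p ^ a ∣ n := fun h => h ▸ Nat.ordProj_dvd _ p
  refine card_le_card_of_injOn (fun n => n / p ^ a) ?_ ?_
  · intro n hn
    obtain ⟨hn, hv⟩ := mem_filter.mp (mem_coe.mp hn)
    obtain ⟨hn, hω⟩ := mem_filter.mp hn
    obtain ⟨hn1, hnx⟩ := mem_Icc.mp hn
    refine mem_coe.mpr (mem_filter.mpr ⟨mem_Icc.mpr ⟨?_, ?_⟩, ?_⟩)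
    · exact Nat.div_pos (Nat.le_of_dvd hn1 (hdvd hv)) hpa
    · rw [← Nat.cast_pow, Nat.floor_div_natCast]
      exact Nat.div_le_div_right hnx
    · have hmem : p ∈ n.primeFactors := by
        rw [← Nat.support_factorization, Finsupp.mem_support_iff, hv]; exact ha
      have : (n / p ^ a).primeFactors = n.primeFactors.erase p := by
        rw [← hv, ← Nat.support_factorization, Nat.factorization_ordCompl,
          Finsupp.support_erase, Nat.support_factorization]
      rw [this, card_erase_of_mem hmem, hω, Nat.add_sub_cancel]
  · intro n hn m hm h
    have hv := (mem_filter.mp (mem_coe.mp hn)).2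
    have hw := (mem_filter.mp (mem_coe.mp hm)).2
    exact (Nat.div_left_inj (hdvd hv) (hdvd hw)).mp h

/-- Every prime factor of `n` except the largest one, taken to its full power, gives an admissible
exponent. -/
theorem le_sum_card_filter_smallExponents {x : ℝ} {k n : ℕ} (hn : n ∈ withOmega x (k + 1)) :
    k ≤ ∑ p ∈ ⌊x⌋₊.primesLE,
      ((smallExponents x p).filter fun a => n.factorization p = a).card := by
  obtain ⟨hn, hω⟩ := mem_filter.mp hn
  obtain ⟨hn1, hnx⟩ := mem_Icc.mp hn
  have hne : n.primeFactors.Nonempty := card_pos.mp (by lia)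
  set P := n.primeFactors.max' hne
  have hPmem : P ∈ n.primeFactors := max'_mem _ hne
  have hle : ∀ {m : ℕ}, m ∣ n → m ≤ ⌊x⌋₊ := fun h => (Nat.le_of_dvd hn1 h).trans hnx
  have hsub : n.primeFactors.erase P ⊆ ⌊x⌋₊.primesLE := fun p hp =>
    Nat.mem_primesLE.mpr ⟨hle (Nat.dvd_of_mem_primeFactors (mem_of_mem_erase hp)),
      Nat.prime_of_mem_primeFactors (mem_of_mem_erase hp)⟩
  calc k = ∑ p ∈ n.primeFactors.erase P, 1 := by
        rw [← card_eq_sum_ones, card_erase_of_mem hPmem, hω, Nat.add_sub_cancel]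
    _ ≤ ∑ p ∈ n.primeFactors.erase P,
        ((smallExponents x p).filter fun a => n.factorization p = a).card := by
        refine sum_le_sum fun p hp => card_pos.mpr ⟨n.factorization p, ?_⟩
        obtain ⟨hpP, hpn⟩ := mem_erase.mp hp
        have hpp := Nat.prime_of_mem_primeFactors hpn
        have hPp := Nat.prime_of_mem_primeFactors hPmem
        have hpdvd := Nat.dvd_of_mem_primeFactors hpn
        have hlt : n.factorization p < p ^ n.factorization p := Nat.lt_pow_self hpp.one_lt
        refine mem_filter.mpr ⟨mem_filter.mpr ⟨mem_Icc.mpr ⟨?_, ?_⟩, ?_⟩, rfl⟩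
        · exact hpp.factorization_pos_of_dvd (Nat.pos_iff_ne_zero.mp hn1) hpdvd
        · exact hlt.le.trans (hle (Nat.ordProj_dvd n p))
        · have hcop : Nat.Coprime (p ^ n.factorization p) P :=
            Nat.Coprime.pow_left _ ((Nat.coprime_primes hpp hPp).mpr hpP)
          calc p ^ (n.factorization p + 1) = p ^ n.factorization p * p := pow_succ _ _
            _ ≤ p ^ n.factorization p * P := by gcongr; exact le_max' _ _ hpn
            _ ≤ ⌊x⌋₊ := hle (hcop.mul_dvd_of_dvd_of_dvd (Nat.ordProj_dvd n p)
                (Nat.dvd_of_mem_primeFactors hPmem))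
    _ ≤ _ := sum_le_sum_of_subset hsub

/-- The recursive inequality of Hardy and Ramanujan. -/
theorem mul_card_withOmega_succ_le (x : ℝ) (k : ℕ) :
    k * (withOmega x (k + 1)).card ≤
      ∑ p ∈ ⌊x⌋₊.primesLE, ∑ a ∈ smallExponents x p, (withOmega (x / (p : ℝ) ^ a) k).card := by
  calc k * (withOmega x (k + 1)).card = ∑ n ∈ withOmega x (k + 1), k := by
        rw [sum_const, smul_eq_mul, mul_comm]
    _ ≤ ∑ n ∈ withOmega x (k + 1), ∑ p ∈ ⌊x⌋₊.primesLE,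
        ((smallExponents x p).filter fun a => n.factorization p = a).card :=
        sum_le_sum fun n hn => le_sum_card_filter_smallExponents hn
    _ = ∑ p ∈ ⌊x⌋₊.primesLE, ∑ a ∈ smallExponents x p,
        ((withOmega x (k + 1)).filter fun n => n.factorization p = a).card := by
        rw [sum_comm]
        exact sum_congr rfl fun p _ =>
          sum_card_bipartiteAbove_eq_sum_card_bipartiteBelow fun (n a : ℕ) => n.factorization p = a
    _ ≤ _ := by
        refine sum_le_sum fun p hp => sum_le_sum fun a ha => ?_
        have ha1 := (mem_Icc.mp (mem_filter.mp ha).1).1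
        exact card_filter_withOmega_le x k a (Nat.prime_of_mem_primesLE hp) (by lia)

theorem sum_range_add_one_div_two_pow_le (n : ℕ) :
    ∑ a ∈ range n, ((a : ℝ) + 1) / 2 ^ a ≤ 4 := by
  have h : ∑ a ∈ range n, ((a : ℝ) + 1) / 2 ^ a = 4 - (n + 1) / 2 ^ n * 2 - 2 / 2 ^ n := by
    induction n with
    | zero => norm_num
    | succ n ih =>
      rw [sum_range_succ, ih]
      push_cast
      field_simp
      ring
  have h1 : (0 : ℝ) ≤ (n + 1) / 2 ^ n * 2 := by positivity
  have h2 : (0 : ℝ) ≤ 2 / 2 ^ n := by positivity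
  linarith

theorem sum_inv_sq_prime_le_one {n : ℕ} (hn : n ≠ 0) :
    ∑ p ∈ n.primesLE, ((p : ℝ) ^ 2)⁻¹ ≤ 1 := by
  rw [Nat.primesLE_eq_filter_Ioc_one]
  have h := sum_Ioc_inv_sq_le_sub (α := ℝ) one_ne_zero (Nat.one_le_iff_ne_zero.mpr hn)
  have hn0 : (0 : ℝ) ≤ (n : ℝ)⁻¹ := by positivity
  calc ∑ p ∈ (Ioc 1 n).filter Nat.Prime, ((p : ℝ) ^ 2)⁻¹
      ≤ ∑ p ∈ Ioc 1 n, ((p : ℝ) ^ 2)⁻¹ :=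
        sum_le_sum_of_subset_of_nonneg (filter_subset _ _) fun _ _ _ => by positivity
    _ ≤ 1 := by
        rw [Nat.cast_one, inv_one] at h
        linarith

/-- If `p ^ (a + 1) ≤ x`, then `log (x / p ^ a)` is comparable with `log x`. -/
theorem log_div_add_one_le_log_div_pow {x p : ℝ} {a : ℕ} (hp : 0 < p) (h : p ^ (a + 1) ≤ x) :
    Real.log x / (a + 1) ≤ Real.log (x / p ^ a) := by
  have hx : 0 < x := (pow_pos hp _).trans_le h
  have hle := Real.log_le_log (pow_pos hp _) h
  rw [Real.log_pow] at hle
  rw [Real.log_div hx.ne' (pow_pos hp a).ne', Real.log_pow, div_le_iff₀ (by positivity)]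
  push_cast at hle
  nlinarith [mul_le_mul_of_nonneg_left hle (Nat.cast_nonneg (α := ℝ) a)]

theorem log_mul_inv_pow_mul_log_le {x p : ℝ} {a : ℕ} (hp : 2 ≤ p) (ha : 1 ≤ a)
    (h : p ^ (a + 1) ≤ x) :
    Real.log x * (p ^ a * Real.log (x / p ^ a))⁻¹ ≤
      (if a = 1 then p⁻¹ + 2 / Real.log x * (Real.log p / p) else 0) +
        4 * (p ^ 2)⁻¹ * ((a + 1) / 2 ^ a) := by
  have hp0 : 0 < p := by linarith
  have hx : 1 < x := (one_lt_pow₀ (by linarith) (by lia)).trans_le h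
  have hL : 0 < Real.log x := Real.log_pos hx
  have hlow := log_div_add_one_le_log_div_pow hp0 h
  have hM : 0 < Real.log (x / p ^ a) := lt_of_lt_of_le (by positivity) hlow
  split_ifs with ha1
  · subst ha1
    have hlog : Real.log (x / p ^ 1) = Real.log x - Real.log p := by
      rw [pow_one, Real.log_div (by linarith) hp0.ne']
    have hlp : 0 ≤ Real.log p := Real.log_nonneg (by linarith)
    rw [hlog] at hlow hM ⊢
    push_cast at hlow
    have key : Real.log x * (p ^ 1 * (Real.log x - Real.log p))⁻¹
        = p⁻¹ + Real.log p / p * (Real.log x - Real.log p)⁻¹ := by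
      field_simp
      ring
    have hinv : (Real.log x - Real.log p)⁻¹ ≤ 2 / Real.log x := by
      rw [inv_le_comm₀ hM (by positivity), inv_div]
      linarith
    have : Real.log p / p * (Real.log x - Real.log p)⁻¹ ≤
        Real.log p / p * (2 / Real.log x) := by gcongr
    have h0 : 0 ≤ 4 * (p ^ 2)⁻¹ * (((1 : ℕ) + 1 : ℝ) / 2 ^ 1) := by positivity
    linarith
  · obtain ⟨b, rfl⟩ : ∃ b, a = b + 2 := ⟨a - 2, by lia⟩
    calc Real.log x * (p ^ (b + 2) * Real.log (x / p ^ (b + 2)))⁻¹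
        ≤ Real.log x * (p ^ (b + 2) * (Real.log x / ((b + 2 : ℕ) + 1)))⁻¹ := by gcongr
      _ = ((b + 2 : ℕ) + 1) * (p ^ 2)⁻¹ * (p ^ b)⁻¹ := by field_simp; ring
      _ ≤ ((b + 2 : ℕ) + 1) * (p ^ 2)⁻¹ * (2 ^ b)⁻¹ := by gcongr
      _ = 0 + 4 * (p ^ 2)⁻¹ * (((b + 2 : ℕ) + 1) / 2 ^ (b + 2)) := by field_simp; ring

theorem pow_succ_le_of_mem_smallExponents {x : ℝ} {p a : ℕ} (hx : 0 ≤ x)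
    (ha : a ∈ smallExponents x p) : (p : ℝ) ^ (a + 1) ≤ x := by
  exact_mod_cast (Nat.le_floor_iff hx).mp (mem_filter.mp ha).2

theorem log_mul_sum_smallExponents_le {x : ℝ} {p : ℕ} (hx : 1 ≤ x) (hp : 2 ≤ p) :
    Real.log x * ∑ a ∈ smallExponents x p, ((p : ℝ) ^ a * Real.log (x / (p : ℝ) ^ a))⁻¹ ≤
      (p : ℝ)⁻¹ + 2 / Real.log x * (Real.log p / p) + 16 * ((p : ℝ) ^ 2)⁻¹ := by
  have hp2 : (2 : ℝ) ≤ p := by exact_mod_cast hp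
  have hX : 0 ≤ (p : ℝ)⁻¹ + 2 / Real.log x * (Real.log p / p) := by
    have := Real.log_nonneg hx
    positivity
  calc Real.log x * ∑ a ∈ smallExponents x p, ((p : ℝ) ^ a * Real.log (x / (p : ℝ) ^ a))⁻¹
      ≤ ∑ a ∈ smallExponents x p,
          ((if a = 1 then (p : ℝ)⁻¹ + 2 / Real.log x * (Real.log p / p) else 0) +
            4 * ((p : ℝ) ^ 2)⁻¹ * ((a + 1) / 2 ^ a)) := by
        rw [mul_sum]
        exact sum_le_sum fun a ha => log_mul_inv_pow_mul_log_le hp2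
          (mem_Icc.mp (mem_filter.mp ha).1).1
          (pow_succ_le_of_mem_smallExponents (by linarith) ha)
    _ ≤ ((p : ℝ)⁻¹ + 2 / Real.log x * (Real.log p / p)) + 4 * ((p : ℝ) ^ 2)⁻¹ * 4 := by
        rw [sum_add_distrib, ← mul_sum, sum_ite_eq']
        have hsub : smallExponents x p ⊆ range (⌊x⌋₊ + 1) := fun a ha =>
          mem_range_succ_iff.mpr (mem_Icc.mp (mem_filter.mp ha).1).2
        gcongr
        · split_ifs
          exacts [le_rfl, hX]
        · exact (sum_le_sum_of_subset_of_nonneg hsub fun _ _ _ => by positivity).trans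
            (sum_range_add_one_div_two_pow_le _)
    _ = _ := by ring

/-- The sum over prime powers which drives the induction. -/
theorem sum_inv_pow_mul_log_le {x : ℝ} (hx : 2 ≤ x) :
    ∑ p ∈ ⌊x⌋₊.primesLE, ∑ a ∈ smallExponents x p,
      ((p : ℝ) ^ a * Real.log (x / (p : ℝ) ^ a))⁻¹ ≤
      (Real.log (Real.log x) + (25 - Real.log (Real.log 2))) / Real.log x := by
  have hL2 : 0 < Real.log 2 := Real.log_pos one_lt_two
  have hLx : Real.log 2 ≤ Real.log x := Real.log_le_log two_pos hx
  have hL : 0 < Real.log x := hL2.trans_le hLx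
  have hN : 2 ≤ ⌊x⌋₊ := Nat.le_floor (by exact_mod_cast hx)
  have hN1 : (1 : ℝ) < ⌊x⌋₊ := by exact_mod_cast hN
  have hNx : Real.log ⌊x⌋₊ ≤ Real.log x :=
    Real.log_le_log (by linarith) (Nat.floor_le (by linarith))
  have hNNx : Real.log (Real.log ⌊x⌋₊) ≤ Real.log (Real.log x) :=
    Real.log_le_log (Real.log_pos hN1) hNx
  have h4 : Real.log 4 = 2 * Real.log 2 := by
    rw [show (4 : ℝ) = 2 ^ 2 by norm_num, Real.log_pow]; norm_num
  have hlogsum : 2 / Real.log x * ∑ p ∈ ⌊x⌋₊.primesLE, Real.log p / p ≤ 6 := by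
    have h := sum_log_div_prime_le_s6 (n := ⌊x⌋₊) (by lia)
    rw [div_mul_eq_mul_div, div_le_iff₀ hL]
    linarith
  rw [le_div_iff₀ hL, mul_comm, mul_sum]
  calc ∑ p ∈ ⌊x⌋₊.primesLE, Real.log x * ∑ a ∈ smallExponents x p,
        ((p : ℝ) ^ a * Real.log (x / (p : ℝ) ^ a))⁻¹
      ≤ ∑ p ∈ ⌊x⌋₊.primesLE,
          ((p : ℝ)⁻¹ + 2 / Real.log x * (Real.log p / p) + 16 * ((p : ℝ) ^ 2)⁻¹) :=
        sum_le_sum fun p hp => log_mul_sum_smallExponents_le (by linarith)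
          (Nat.two_le_of_mem_primesLE hp)
    _ ≤ _ := by
        rw [sum_add_distrib, sum_add_distrib, ← mul_sum, ← mul_sum]
        linarith [sum_inv_prime_le hN, sum_inv_sq_prime_le_one (n := ⌊x⌋₊) (by lia)]

/-- The Hardy–Ramanujan inequality for `k + 1` prime factors, propagated by induction from
a bound for prime powers. -/
theorem card_withOmega_succ_le {C : ℝ} (hC : 0 ≤ C)
    (hbase : ∀ x : ℝ, 2 ≤ x → ((withOmega x 1).card : ℝ) ≤ C * (x / Real.log x)) (k : ℕ) :
    ∀ x : ℝ, 2 ≤ x → ((withOmega x (k + 1)).card : ℝ) ≤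
      C * (x / Real.log x) *
        (Real.log (Real.log x) + (25 - Real.log (Real.log 2))) ^ k / (k.factorial : ℝ) := by
  induction k with
  | zero => simpa using hbase
  | succ k ih =>
    intro x hx
    set c := 25 - Real.log (Real.log 2) with hc
    have hL2 : 0 < Real.log 2 := Real.log_pos one_lt_two
    have hnonneg : ∀ y : ℝ, 2 ≤ y → 0 ≤ Real.log (Real.log y) + c := fun y hy => by
      have := Real.log_le_log hL2 (Real.log_le_log two_pos hy)
      linarith
    have hterm : ∀ p ∈ ⌊x⌋₊.primesLE, ∀ a ∈ smallExponents x p,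
        ((withOmega (x / (p : ℝ) ^ a) (k + 1)).card : ℝ) ≤
          C * x * (Real.log (Real.log x) + c) ^ k / (k.factorial : ℝ) *
            ((p : ℝ) ^ a * Real.log (x / (p : ℝ) ^ a))⁻¹ := by
      intro p hp a ha
      have hp2 : (2 : ℝ) ≤ p := by exact_mod_cast Nat.two_le_of_mem_primesLE hp
      have hpa : 0 < (p : ℝ) ^ a := by positivity
      have hy : 2 ≤ x / (p : ℝ) ^ a := by
        rw [le_div_iff₀ hpa]
        have := pow_succ_le_of_mem_smallExponents (by linarith) ha
        rw [pow_succ] at this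
        nlinarith
      have hyx : x / (p : ℝ) ^ a ≤ x :=
        div_le_self (by linarith) (one_le_pow₀ (by linarith))
      have hly : 0 < Real.log (x / (p : ℝ) ^ a) := Real.log_pos (by linarith)
      have hmono : Real.log (Real.log (x / (p : ℝ) ^ a)) ≤ Real.log (Real.log x) :=
        Real.log_le_log hly (Real.log_le_log (by linarith) hyx)
      have h0 := hnonneg _ hy
      calc ((withOmega (x / (p : ℝ) ^ a) (k + 1)).card : ℝ)
          ≤ C * (x / (p : ℝ) ^ a / Real.log (x / (p : ℝ) ^ a)) *
            (Real.log (Real.log (x / (p : ℝ) ^ a)) + c) ^ k / (k.factorial : ℝ) := ih _ hy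
        _ ≤ C * (x / (p : ℝ) ^ a / Real.log (x / (p : ℝ) ^ a)) *
            (Real.log (Real.log x) + c) ^ k / (k.factorial : ℝ) := by gcongr
        _ = _ := by rw [div_div, div_eq_mul_inv x]; ring
    have hrec : ((k + 1 : ℕ) : ℝ) * ((withOmega x (k + 2)).card : ℝ) ≤
        ∑ p ∈ ⌊x⌋₊.primesLE, ∑ a ∈ smallExponents x p,
          ((withOmega (x / (p : ℝ) ^ a) (k + 1)).card : ℝ) := by
      exact_mod_cast mul_card_withOmega_succ_le x (k + 1)
    have hA : 0 ≤ C * x * (Real.log (Real.log x) + c) ^ k / (k.factorial : ℝ) := by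
      have := hnonneg x hx
      positivity
    have hmain : ((k + 1 : ℕ) : ℝ) * ((withOmega x (k + 2)).card : ℝ) ≤
        C * x * (Real.log (Real.log x) + c) ^ k / (k.factorial : ℝ) *
          ((Real.log (Real.log x) + c) / Real.log x) := by
      refine hrec.trans ((sum_le_sum fun p hp => sum_le_sum (hterm p hp)).trans ?_)
      simp_rw [← mul_sum]
      exact mul_le_mul_of_nonneg_left (sum_inv_pow_mul_log_le hx) hA
    rw [mul_comm, ← le_div_iff₀ (by positivity)] at hmain
    refine hmain.trans_eq ?_
    rw [Nat.factorial_succ, Nat.cast_mul, pow_succ]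
    field_simp

/-- The classical Hardy–Ramanujan inequality: the number of `n ≤ x` with `ω(n) = k`
is at most `C₁ (x / log x) (log log x + C₂)^(k-1) / (k-1)!`, uniformly in `k ≥ 1`. -/
theorem hardy_ramanujan :
    ∃ C₁ C₂ : ℝ, ∀ (x : ℝ) (k : ℕ), 2 ≤ x → 1 ≤ k →
      (((Finset.Icc 1 ⌊x⌋₊).filter (fun n => n.primeFactors.card = k)).card : ℝ)
        ≤ C₁ * (x / Real.log x) * (Real.log (Real.log x) + C₂) ^ (k - 1) /
            (Nat.factorial (k - 1) : ℝ) := by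
  have hl2 : 0 < Real.log 2 := Real.log_pos one_lt_two
  have hl4 : 0 < Real.log 4 := Real.log_pos (by norm_num)
  refine ⟨2 * Real.log 4 + 2 + 16 / Real.log 2, 25 - Real.log (Real.log 2), fun x k hx hk => ?_⟩
  obtain ⟨k, rfl⟩ := Nat.exists_eq_add_of_le' hk
  exact card_withOmega_succ_le (by positivity) (fun y hy => card_withOmega_one_le hy) k x hx
end
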